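/- Let ℰ ⊆ U_q(g) = U_q(gl(2n)) be the unital subalgebra generated by C_i^{±1} (1 ≤ i ≤ n) and B_j (j ∈ {1,…,2n−1}, j ≠ n). Then the assignment K_i^{±1} ↦ C_i^{±1} (1 ≤ i ≤ n), y_j ↦ B_j C_{j+1} and x_j ↦ B_{2n−j} C_j (1 ≤ j ≤ n−1) extends to an algebra isomorphism from U_q(gl(n)) onto ℰ. -/

import Mathlib

namespace QG

/-- Generators of the quantized universal enveloping algebra `U_q(gl(m))`:
`K i`, its inverse `Ki i`, and the Chevalley generators `E j` (the `x_j`)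
and `F j` (the `y_j`).  Indices are 1-based natural numbers; out-of-range
generators are forced to be `1` (resp. `0`) by the relations. -/
inductive Gen : Type where
  | K : ℕ → Gen
  | Ki : ℕ → Gen
  | E : ℕ → Gen
  | F : ℕ → Gen

abbrev FA := FreeAlgebra ℂ Gen

noncomputable def fK (i : ℕ) : FA := FreeAlgebra.ι ℂ (Gen.K i)
noncomputable def fKi (i : ℕ) : FA := FreeAlgebra.ι ℂ (Gen.Ki i)
noncomputable def fE (i : ℕ) : FA := FreeAlgebra.ι ℂ (Gen.E i)
noncomputable def fF (i : ℕ) : FA := FreeAlgebra.ι ℂ (Gen.F i)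

/-- Kronecker delta with values in `ℤ`. -/
def kd (i j : ℕ) : ℤ := if i = j then 1 else 0

/-- The defining relations of `U_q(gl(m))`. -/
inductive Rel (q : ℝ) (m : ℕ) : FA → FA → Prop
  | Kout : ∀ i, ¬(1 ≤ i ∧ i ≤ m) → Rel q m (fK i) 1
  | Kiout : ∀ i, ¬(1 ≤ i ∧ i ≤ m) → Rel q m (fKi i) 1
  | Eout : ∀ j, ¬(1 ≤ j ∧ j + 1 ≤ m) → Rel q m (fE j) 0
  | Fout : ∀ j, ¬(1 ≤ j ∧ j + 1 ≤ m) → Rel q m (fF j) 0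
  | KK : ∀ i j, Rel q m (fK i * fK j) (fK j * fK i)
  | KKi : ∀ i, Rel q m (fK i * fKi i) 1
  | KiK : ∀ i, Rel q m (fKi i * fK i) 1
  | KE : ∀ i j, 1 ≤ i → i ≤ m → 1 ≤ j → j + 1 ≤ m →
      Rel q m (fK i * fE j) (((q : ℂ) ^ (kd i j - kd i (j+1))) • (fE j * fK i))
  | KF : ∀ i j, 1 ≤ i → i ≤ m → 1 ≤ j → j + 1 ≤ m →
      Rel q m (fK i * fF j) (((q : ℂ) ^ (kd i (j+1) - kd i j)) • (fF j * fK i))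
  | EF : ∀ i j, 1 ≤ i → i + 1 ≤ m → 1 ≤ j → j + 1 ≤ m →
      Rel q m (fE i * fF j - fF j * fE i)
        (if i = j then ((q : ℂ) - (q : ℂ)⁻¹)⁻¹ • (fK i * fKi (i+1) - fKi i * fK (i+1)) else 0)
  | EE : ∀ i j, 1 ≤ i → i + 1 ≤ m → 1 ≤ j → j + 1 ≤ m → (i + 2 ≤ j ∨ j + 2 ≤ i) →
      Rel q m (fE i * fE j) (fE j * fE i)
  | FF : ∀ i j, 1 ≤ i → i + 1 ≤ m → 1 ≤ j → j + 1 ≤ m → (i + 2 ≤ j ∨ j + 2 ≤ i) →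
      Rel q m (fF i * fF j) (fF j * fF i)
  | Eserre : ∀ i j, 1 ≤ i → i + 1 ≤ m → 1 ≤ j → j + 1 ≤ m → (i + 1 = j ∨ j + 1 = i) →
      Rel q m (fE i ^ 2 * fE j - ((q : ℂ) + (q : ℂ)⁻¹) • (fE i * fE j * fE i) + fE j * fE i ^ 2) 0
  | Fserre : ∀ i j, 1 ≤ i → i + 1 ≤ m → 1 ≤ j → j + 1 ≤ m → (i + 1 = j ∨ j + 1 = i) →
      Rel q m (fF i ^ 2 * fF j - ((q : ℂ) + (q : ℂ)⁻¹) • (fF i * fF j * fF i) + fF j * fF i ^ 2) 0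

/-- The quantized universal enveloping algebra `U_q(gl(m))`. -/
abbrev Uq (q : ℝ) (m : ℕ) := RingQuot (Rel q m)

noncomputable def uK (q : ℝ) (m i : ℕ) : Uq q m := RingQuot.mkAlgHom ℂ (Rel q m) (fK i)
noncomputable def uKi (q : ℝ) (m i : ℕ) : Uq q m := RingQuot.mkAlgHom ℂ (Rel q m) (fKi i)
noncomputable def uE (q : ℝ) (m i : ℕ) : Uq q m := RingQuot.mkAlgHom ℂ (Rel q m) (fE i)
noncomputable def uF (q : ℝ) (m i : ℕ) : Uq q m := RingQuot.mkAlgHom ℂ (Rel q m) (fF i)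

/-- `C_i = K_i K_{2n+1-i}` in `U_q(gl(2n))`. -/
noncomputable def Cc (q : ℝ) (n i : ℕ) : Uq q (2*n) := uK q (2*n) i * uK q (2*n) (2*n+1-i)
/-- `C_i⁻¹ = K_i⁻¹ K_{2n+1-i}⁻¹` in `U_q(gl(2n))`. -/
noncomputable def Ccinv (q : ℝ) (n i : ℕ) : Uq q (2*n) := uKi q (2*n) i * uKi q (2*n) (2*n+1-i)
/-- `B_j = y_j K_{j+1}⁻¹ K_{2n-j}⁻¹ + K_j⁻¹ x_{2n-j} K_{2n-j}⁻¹` in `U_q(gl(2n))`. -/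
noncomputable def Bb (q : ℝ) (n j : ℕ) : Uq q (2*n) :=
  uF q (2*n) j * uKi q (2*n) (j+1) * uKi q (2*n) (2*n-j)
  + uKi q (2*n) j * uE q (2*n) (2*n-j) * uKi q (2*n) (2*n-j)
/-- `B_n^σ = y_n K_{n+1}⁻¹ K_n⁻¹ + K_n⁻¹ x_n K_n⁻¹ + ((q^{-σ}-q^{σ})/(q-q⁻¹)) K_n⁻²`. -/
noncomputable def Bs (q σ : ℝ) (n : ℕ) : Uq q (2*n) :=
  uF q (2*n) n * uKi q (2*n) (n+1) * uKi q (2*n) n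
  + uKi q (2*n) n * uE q (2*n) n * uKi q (2*n) n
  + (((q ^ (-σ) - q ^ σ) / (q - q⁻¹) : ℝ) : ℂ) • ((uKi q (2*n) n)^2)

/-- The generating set of the coideal subalgebra `𝒜_σ ⊆ U_q(gl(2n))`. -/
def ASet (q σ : ℝ) (n : ℕ) : Set (Uq q (2*n)) :=
  {z | (∃ i, 1 ≤ i ∧ i ≤ 2*n ∧ (z = Cc q n i ∨ z = Ccinv q n i)) ∨
       (∃ j, 1 ≤ j ∧ j + 1 ≤ 2*n ∧ j ≠ n ∧ z = Bb q n j) ∨ z = Bs q σ n}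

/-- Generators of the abstract algebra `𝒜`. -/
inductive AGen : Type where
  | g : ℕ → AGen
  | gi : ℕ → AGen
  | b : ℕ → AGen

abbrev AFA := FreeAlgebra ℂ AGen

noncomputable def fγ (i : ℕ) : AFA := FreeAlgebra.ι ℂ (AGen.g i)
noncomputable def fγi (i : ℕ) : AFA := FreeAlgebra.ι ℂ (AGen.gi i)
noncomputable def fβ (j : ℕ) : AFA := FreeAlgebra.ι ℂ (AGen.b j)

/-- `(ε_i + ε_{2n+1-i}, α_j)` where `α_j = ε_j - ε_{j+1}`. -/
def gex (n i j : ℕ) : ℤ := kd i j + kd (2*n+1-i) j - kd i (j+1) - kd (2*n+1-i) (j+1)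

/-- The defining relations of the algebra `𝒜`. -/
inductive ARel (q : ℝ) (n : ℕ) : AFA → AFA → Prop
  | gout : ∀ i, ¬(1 ≤ i ∧ i ≤ 2*n) → ARel q n (fγ i) 1
  | giout : ∀ i, ¬(1 ≤ i ∧ i ≤ 2*n) → ARel q n (fγi i) 1
  | bout : ∀ j, ¬(1 ≤ j ∧ j + 1 ≤ 2*n) → ARel q n (fβ j) 0
  | gg : ∀ i j, ARel q n (fγ i * fγ j) (fγ j * fγ i)
  | ggi : ∀ i, ARel q n (fγ i * fγi i) 1
  | gig : ∀ i, ARel q n (fγi i * fγ i) 1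
  | gsym : ∀ i, 1 ≤ i → i ≤ 2*n → ARel q n (fγ i) (fγ (2*n+1-i))
  | gb : ∀ i j, 1 ≤ i → i ≤ 2*n → 1 ≤ j → j + 1 ≤ 2*n →
      ARel q n (fγ i * fβ j) (((q : ℂ) ^ (-(gex n i j))) • (fβ j * fγ i))
  | bb : ∀ i j, 1 ≤ i → i + 1 ≤ 2*n → 1 ≤ j → j + 1 ≤ 2*n → (i + 2 ≤ j ∨ j + 2 ≤ i) →
      ARel q n (fβ i * fβ j - fβ j * fβ i)
        (if i + j = 2*n then ((q : ℂ) * ((q : ℂ) - (q : ℂ)⁻¹)⁻¹) • (fγi i ^ 2 - fγi (i+1) ^ 2)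
         else 0)
  | serre1 : ∀ i, 1 ≤ i → i + 2 ≤ 2*n →
      ARel q n
        ((q : ℂ)⁻¹ • (fβ i ^ 2 * fβ (i+1)) - ((q : ℂ) + (q : ℂ)⁻¹) • (fβ i * fβ (i+1) * fβ i)
          + (q : ℂ) • (fβ (i+1) * fβ i ^ 2))
        (if i = n then (q : ℂ) • (fβ (n+1) * fγi n ^ 2) else 0)
  | serre2 : ∀ i, 2 ≤ i → i + 1 ≤ 2*n →
      ARel q n
        ((q : ℂ) • (fβ i ^ 2 * fβ (i-1)) - ((q : ℂ) + (q : ℂ)⁻¹) • (fβ i * fβ (i-1) * fβ i)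
          + (q : ℂ)⁻¹ • (fβ (i-1) * fβ i ^ 2))
        (if i = n then (q : ℂ)⁻¹ • (fβ (n-1) * fγi n ^ 2) else 0)

/-- The abstract algebra `𝒜`. -/
abbrev Aalg (q : ℝ) (n : ℕ) := RingQuot (ARel q n)

noncomputable def aγ (q : ℝ) (n i : ℕ) : Aalg q n := RingQuot.mkAlgHom ℂ (ARel q n) (fγ i)
noncomputable def aγi (q : ℝ) (n i : ℕ) : Aalg q n := RingQuot.mkAlgHom ℂ (ARel q n) (fγi i)
noncomputable def aβ (q : ℝ) (n j : ℕ) : Aalg q n := RingQuot.mkAlgHom ℂ (ARel q n) (fβ j)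

end QG

namespace QG

/-- The generating set of the subalgebra `ℰ ⊆ U_q(gl(2n))`: the `C_i^{±1}` for
`1 ≤ i ≤ n` and the `B_j` for `j ∈ {1,…,2n−1}`, `j ≠ n`. -/
def ESet (q : ℝ) (n : ℕ) : Set (Uq q (2*n)) :=
  {z | (∃ i, 1 ≤ i ∧ i ≤ n ∧ (z = Cc q n i ∨ z = Ccinv q n i)) ∨
       (∃ j, 1 ≤ j ∧ j + 1 ≤ 2*n ∧ j ≠ n ∧ z = Bb q n j)}

end QG

namespace QG

noncomputable section Serre

variable {A : Type*} [Ring A] [Algebra ℂ A]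

/-- The `q`-Serre expression in `a` (quadratic) and `b` (linear). -/
def qSerre (s : ℂ) (a b : A) : A := a ^ 2 * b - (s + s⁻¹) • (a * b * a) + b * a ^ 2

theorem qSerre_inv (s : ℂ) (a b : A) : qSerre s⁻¹ a b = qSerre s a b := by
  simp only [qSerre, inv_inv, add_comm s⁻¹]

theorem left_comm_of_smul {x y : A} {t : ℂ} (h : x * y = t • (y * x)) (z : A) :
    x * (y * z) = t • (y * (x * z)) := by
  rw [← mul_assoc, h, smul_mul_assoc, mul_assoc]

theorem inv_mul_comm_smul {k ki x : A} {t : ℂ} (ht : t ≠ 0) (h : k * x = t • (x * k))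
    (hk : k * ki = 1) (hk' : ki * k = 1) : ki * x = t⁻¹ • (x * ki) := by
  have h1 : ki * (k * x) * ki = t • (ki * (x * k) * ki) := by rw [h]; simp
  have h2 : ki * (k * x) * ki = x * ki := by rw [← mul_assoc, hk', one_mul]
  have h3 : ki * (x * k) * ki = ki * x := by rw [mul_assoc, mul_assoc x, hk, mul_one]
  rw [h2, h3] at h1
  rw [h1, inv_smul_smul₀ ht]

theorem mul_mul_comm_smul {k l x : A} {s t : ℂ} (hk : k * x = s • (x * k))
    (hl : l * x = t • (x * l)) : k * l * x = (s * t) • (x * (k * l)) := by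
  rw [mul_assoc, hl, mul_smul_comm, ← mul_assoc, hk, smul_mul_assoc, smul_smul, mul_comm t,
    mul_assoc]

theorem mul_qSerre_comm_smul {k a b : A} {s t r : ℂ} (ha : k * a = s • (a * k))
    (hb : k * b = t • (b * k)) :
    k * qSerre r a b = (s ^ 2 * t) • (qSerre r a b * k) := by
  simp only [qSerre, pow_two, mul_add, mul_sub, add_mul, sub_mul, mul_assoc, smul_mul_assoc,
    mul_smul_comm, ha, hb, left_comm_of_smul ha, left_comm_of_smul hb]
  module

theorem mul_commutator_comm_smul {k a b : A} {s t : ℂ} (ha : k * a = s • (a * k))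
    (hb : k * b = t • (b * k)) :
    k * (a * b - b * a) = (s * t) • ((a * b - b * a) * k) := by
  simp only [mul_sub, sub_mul, mul_assoc, mul_smul_comm, ha, hb, left_comm_of_smul ha,
    left_comm_of_smul hb]
  module

omit [Algebra ℂ A] in
theorem left_bracket {e a h : A} (hea : e * a - a * e = h) (z : A) :
    e * (a * z) = a * (e * z) + h * z := by
  rw [← hea]; noncomm_ring

theorem qSerre_commute_fst {s c : ℂ} (hs : s ≠ 0) {a b e k l : A}
    (hea : e * a - a * e = c • (k - l)) (heb : e * b - b * e = 0)
    (hka : k * a = s ^ 2 • (a * k)) (hla : l * a = (s⁻¹ ^ 2) • (a * l))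
    (hkb : k * b = s⁻¹ • (b * k)) (hlb : l * b = s • (b * l)) :
    e * qSerre s a b = qSerre s a b * e := by
  have hea' := sub_eq_iff_eq_add'.1 hea
  have heb' := sub_eq_zero.1 heb
  have heb2 := left_bracket heb
  simp only [zero_mul, add_zero] at heb2
  simp only [qSerre, pow_two, mul_add, mul_sub, add_mul, sub_mul, mul_assoc, smul_mul_assoc,
    mul_smul_comm, hea', left_bracket hea, heb', heb2, hka, hla, hkb, hlb,
    left_comm_of_smul hka, left_comm_of_smul hla, left_comm_of_smul hkb, left_comm_of_smul hlb]
  match_scalars <;> field_simp <;> ring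

theorem qSerre_commute_snd {s c : ℂ} (hs : s ≠ 0) {a b e k l : A}
    (hea : e * a - a * e = 0) (heb : e * b - b * e = c • (k - l))
    (hka : k * a = s • (a * k)) (hla : l * a = s⁻¹ • (a * l)) :
    e * qSerre s a b = qSerre s a b * e := by
  have heb' := sub_eq_iff_eq_add'.1 heb
  have hea' := sub_eq_zero.1 hea
  have hea2 := left_bracket hea
  simp only [zero_mul, add_zero] at hea2
  simp only [qSerre, pow_two, mul_add, mul_sub, add_mul, sub_mul, mul_assoc, smul_mul_assoc,
    mul_smul_comm, hea', left_bracket heb, heb', hea2, hka, hla,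
    left_comm_of_smul hka, left_comm_of_smul hla]
  match_scalars <;> field_simp <;> ring

theorem qSerre_commute_of_commute {s : ℂ} {a b e : A}
    (hea : e * a - a * e = 0) (heb : e * b - b * e = 0) :
    e * qSerre s a b = qSerre s a b * e := by
  have ha : Commute e a := sub_eq_zero.1 hea
  have hb : Commute e b := sub_eq_zero.1 heb
  exact ((((ha.pow_right 2).mul_right hb).sub_right
    (((ha.mul_right hb).mul_right ha).smul_right _)).add_right (hb.mul_right (ha.pow_right 2))).eq

theorem commutator_commute {c : ℂ} {a b e k l : A}
    (hea : e * a - a * e = c • (k - l)) (heb : e * b - b * e = 0)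
    (hkb : k * b = b * k) (hlb : l * b = b * l) :
    e * (a * b - b * a) = (a * b - b * a) * e := by
  have hea' := sub_eq_iff_eq_add'.1 hea
  have heb' := sub_eq_zero.1 heb
  have heb2 := left_bracket heb
  simp only [zero_mul, add_zero] at heb2
  simp only [mul_add, mul_sub, sub_mul, mul_assoc, smul_mul_assoc,
    mul_smul_comm, hea', left_bracket hea, heb', heb2, hkb, hlb]
  module

theorem qSerre_add {s : ℂ} (hs : s ≠ 0) {a b a' b' : A}
    (haa : a' * a = s ^ 2 • (a * a')) (hab : a' * b = s⁻¹ • (b * a'))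
    (hba : b' * a = s⁻¹ • (a * b')) (h : qSerre s a b = 0) (h' : qSerre s a' b' = 0) :
    qSerre s (a + a') (b + b') = 0 := by
  have key : qSerre s (a + a') (b + b') = qSerre s a b + qSerre s a' b' := by
    simp only [qSerre, pow_two, mul_add, add_mul, mul_assoc, smul_mul_assoc,
      mul_smul_comm, haa, hab, hba, left_comm_of_smul haa, left_comm_of_smul hab,
      left_comm_of_smul hba]
    match_scalars <;> field_simp <;> ring
  rw [key, h, h', add_zero]

theorem qSerre_mul_right {s : ℂ} {a b k l : A} (hka : Commute k a) (hkb : Commute k b)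
    (hla : Commute l a) (hkl : Commute k l) :
    qSerre s (a * k) (b * l) = qSerre s a b * (k * k * l) := by
  have h1 : ∀ z, k * (a * z) = a * (k * z) := hka.left_comm
  have h2 : ∀ z, k * (b * z) = b * (k * z) := hkb.left_comm
  have h3 : ∀ z, l * (a * z) = a * (l * z) := hla.left_comm
  simp only [qSerre, pow_two, add_mul, sub_mul, mul_assoc, smul_mul_assoc,
    h1, h2, h3, hkl.eq.symm, hkl.symm.left_comm]

end Serre

end QG
namespace QG

theorem commute_of_inverse {M : Type*} [Monoid M] {k ki x : M} (h : Commute k x)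
    (hk : k * ki = 1) (hk' : ki * k = 1) : Commute ki x :=
  Commute.units_inv_left (u := ⟨k, ki, hk, hk'⟩) h

/-- `(α_i, ε_j - ε_{j+1})`, the entries of the Cartan matrix of type `A`. -/
def cartan (i j : ℕ) : ℤ := kd i j - kd i (j + 1) - (kd (i + 1) j - kd (i + 1) (j + 1))

theorem cartan_self (i : ℕ) : cartan i i = 2 := by simp [cartan, kd]

theorem cartan_near {i j : ℕ} (h : i + 1 = j ∨ j + 1 = i) : cartan i j = -1 := by
  rcases h with rfl | rfl <;> simp [cartan, kd] <;> omega

theorem cartan_far {i j : ℕ} (h : i + 2 ≤ j ∨ j + 2 ≤ i) : cartan i j = 0 := by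
  unfold cartan kd
  split_ifs <;> omega

theorem cartan_symm (i j : ℕ) : cartan i j = cartan j i := by
  unfold cartan kd
  split_ifs <;> omega

section Relations

variable {A : Type*} [Ring A] [Algebra ℂ A]

/-- The relations of `U_q(gl)` except the Serre relations, for generators indexed by `D`. -/
structure GlCore (q : ℂ) (D : Set ℕ) (K Ki E F : ℕ → A) : Prop where
  KK : ∀ i ∈ D, ∀ j ∈ D, K i * K j = K j * K i
  KKi : ∀ i ∈ D, K i * Ki i = 1
  KiK : ∀ i ∈ D, Ki i * K i = 1
  KE : ∀ i ∈ D, ∀ j ∈ D, j + 1 ∈ D → K i * E j = q ^ (kd i j - kd i (j + 1)) • (E j * K i)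
  KF : ∀ i ∈ D, ∀ j ∈ D, j + 1 ∈ D → K i * F j = q ^ (kd i (j + 1) - kd i j) • (F j * K i)
  EF : ∀ i ∈ D, i + 1 ∈ D → ∀ j ∈ D, j + 1 ∈ D → E i * F j - F j * E i =
    if i = j then (q - q⁻¹)⁻¹ • (K i * Ki (i + 1) - Ki i * K (i + 1)) else 0

/-- The relations of `U_q(gl)` for generators indexed by `D`. -/
structure GlRel (q : ℂ) (D : Set ℕ) (K Ki E F : ℕ → A) : Prop extends GlCore q D K Ki E F where
  EE : ∀ i ∈ D, i + 1 ∈ D → ∀ j ∈ D, j + 1 ∈ D → (i + 2 ≤ j ∨ j + 2 ≤ i) →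
    E i * E j - E j * E i = 0
  FF : ∀ i ∈ D, i + 1 ∈ D → ∀ j ∈ D, j + 1 ∈ D → (i + 2 ≤ j ∨ j + 2 ≤ i) →
    F i * F j - F j * F i = 0
  Eserre : ∀ i ∈ D, i + 1 ∈ D → ∀ j ∈ D, j + 1 ∈ D → (i + 1 = j ∨ j + 1 = i) →
    qSerre q (E i) (E j) = 0
  Fserre : ∀ i ∈ D, i + 1 ∈ D → ∀ j ∈ D, j + 1 ∈ D → (i + 1 = j ∨ j + 1 = i) →
    qSerre q (F i) (F j) = 0

namespace GlCore

variable {q : ℂ} {D : Set ℕ} {K Ki E F : ℕ → A}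

section Torus

variable (h : GlCore q D K Ki E F) {i j : ℕ} (hi : i ∈ D) (hj : j ∈ D)
include h hi hj

theorem commute_K_K : Commute (K i) (K j) := h.KK i hi j hj

theorem commute_Ki_K : Commute (Ki i) (K j) :=
  commute_of_inverse (h.commute_K_K hi hj) (h.KKi i hi) (h.KiK i hi)

theorem commute_K_Ki : Commute (K i) (Ki j) := (h.commute_Ki_K hj hi).symm

theorem commute_Ki_Ki : Commute (Ki i) (Ki j) :=
  commute_of_inverse (h.commute_K_Ki hi hj) (h.KKi i hi) (h.KiK i hi)

end Torus

section Weights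

variable (h : GlCore q D K Ki E F) (hq : q ≠ 0) {i j : ℕ}
include h hq

theorem Ki_mul_E (hi : i ∈ D) (hj : j ∈ D) (hj' : j + 1 ∈ D) :
    Ki i * E j = (q ^ (kd i j - kd i (j + 1)))⁻¹ • (E j * Ki i) :=
  inv_mul_comm_smul (zpow_ne_zero _ hq) (h.KE i hi j hj hj') (h.KKi i hi) (h.KiK i hi)

theorem Ki_mul_F (hi : i ∈ D) (hj : j ∈ D) (hj' : j + 1 ∈ D) :
    Ki i * F j = (q ^ (kd i (j + 1) - kd i j))⁻¹ • (F j * Ki i) :=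
  inv_mul_comm_smul (zpow_ne_zero _ hq) (h.KF i hi j hj hj') (h.KKi i hi) (h.KiK i hi)

variable (hi : i ∈ D) (hi' : i + 1 ∈ D) (hj : j ∈ D) (hj' : j + 1 ∈ D)
include hi hi' hj hj'

theorem k_mul_E : K i * Ki (i + 1) * E j = q ^ cartan i j • (E j * (K i * Ki (i + 1))) := by
  rw [mul_mul_comm_smul (h.KE i hi j hj hj') (h.Ki_mul_E hq hi' hj hj'), ← zpow_neg,
    ← zpow_add₀ hq]
  congr 2

theorem l_mul_E :
    Ki i * K (i + 1) * E j = (q⁻¹) ^ cartan i j • (E j * (Ki i * K (i + 1))) := by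
  rw [mul_mul_comm_smul (h.Ki_mul_E hq hi hj hj') (h.KE (i + 1) hi' j hj hj'), ← zpow_neg,
    ← zpow_add₀ hq, inv_zpow, ← zpow_neg]
  congr 2
  unfold cartan; ring

theorem k_mul_F :
    K i * Ki (i + 1) * F j = (q⁻¹) ^ cartan i j • (F j * (K i * Ki (i + 1))) := by
  rw [mul_mul_comm_smul (h.KF i hi j hj hj') (h.Ki_mul_F hq hi' hj hj'), ← zpow_neg,
    ← zpow_add₀ hq, inv_zpow, ← zpow_neg]
  congr 2
  unfold cartan; ring

theorem l_mul_F : Ki i * K (i + 1) * F j = q ^ cartan i j • (F j * (Ki i * K (i + 1))) := by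
  rw [mul_mul_comm_smul (h.Ki_mul_F hq hi hj hj') (h.KF (i + 1) hi' j hj hj'), ← zpow_neg,
    ← zpow_add₀ hq]
  congr 2
  unfold cartan; ring

end Weights

section CommuteSerre

variable (h : GlCore q D K Ki E F) (hq : q ≠ 0)
include h

theorem FE {i j : ℕ} (hi : i ∈ D) (hi' : i + 1 ∈ D) (hj : j ∈ D) (hj' : j + 1 ∈ D) :
    F i * E j - E j * F i =
      if i = j then (-(q - q⁻¹)⁻¹) • (K i * Ki (i + 1) - Ki i * K (i + 1)) else 0 := by
  rw [← neg_sub, h.EF j hj hj' i hi hi']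
  split_ifs with h1 h2 h2
  · subst h1; rw [neg_smul]
  · exact absurd h1.symm h2
  · exact absurd h2.symm h1
  · exact neg_zero

include hq

variable {i j p : ℕ} (hi : i ∈ D) (hi' : i + 1 ∈ D) (hj : j ∈ D) (hj' : j + 1 ∈ D)
  (hp : p ∈ D) (hp' : p + 1 ∈ D)
include hi hi' hj hj' hp hp'

theorem E_mul_qSerre_F (hij : i + 1 = j ∨ j + 1 = i) :
    E p * qSerre q (F i) (F j) = qSerre q (F i) (F j) * E p := by
  have h1 := h.EF p hp hp' i hi hi'
  have h2 := h.EF p hp hp' j hj hj'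
  have hne : i ≠ j := by omega
  rcases eq_or_ne p i with rfl | hpi
  · rw [if_pos rfl] at h1
    rw [if_neg hne] at h2
    rw [← qSerre_inv]
    refine qSerre_commute_fst (inv_ne_zero hq) h1 h2 ?_ ?_ ?_ ?_
    · rw [h.k_mul_F hq hp hp' hi hi', cartan_self, zpow_ofNat]
    · rw [h.l_mul_F hq hp hp' hi hi', cartan_self, zpow_ofNat, inv_inv]
    · rw [h.k_mul_F hq hp hp' hj hj', cartan_near hij, zpow_neg_one]
    · rw [h.l_mul_F hq hp hp' hj hj', cartan_near hij, zpow_neg_one]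
  rw [if_neg hpi] at h1
  rcases eq_or_ne p j with rfl | hpj
  · rw [if_pos rfl] at h2
    refine qSerre_commute_snd hq h1 h2 ?_ ?_
    · rw [h.k_mul_F hq hp hp' hi hi', cartan_near hij.symm, zpow_neg_one, inv_inv]
    · rw [h.l_mul_F hq hp hp' hi hi', cartan_near hij.symm, zpow_neg_one]
  · rw [if_neg hpj] at h2
    exact qSerre_commute_of_commute h1 h2

theorem F_mul_qSerre_E (hij : i + 1 = j ∨ j + 1 = i) :
    F p * qSerre q (E i) (E j) = qSerre q (E i) (E j) * F p := by
  have h1 := h.FE hp hp' hi hi'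
  have h2 := h.FE hp hp' hj hj'
  have hne : i ≠ j := by omega
  rcases eq_or_ne p i with rfl | hpi
  · rw [if_pos rfl] at h1
    rw [if_neg hne] at h2
    refine qSerre_commute_fst hq h1 h2 ?_ ?_ ?_ ?_
    · rw [h.k_mul_E hq hp hp' hi hi', cartan_self, zpow_ofNat]
    · rw [h.l_mul_E hq hp hp' hi hi', cartan_self, zpow_ofNat]
    · rw [h.k_mul_E hq hp hp' hj hj', cartan_near hij, zpow_neg_one]
    · rw [h.l_mul_E hq hp hp' hj hj', cartan_near hij, zpow_neg_one, inv_inv]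
  rw [if_neg hpi] at h1
  rcases eq_or_ne p j with rfl | hpj
  · rw [if_pos rfl] at h2
    rw [← qSerre_inv]
    refine qSerre_commute_snd (inv_ne_zero hq) h1 h2 ?_ ?_
    · rw [h.k_mul_E hq hp hp' hi hi', cartan_near hij.symm, zpow_neg_one]
    · rw [h.l_mul_E hq hp hp' hi hi', cartan_near hij.symm, zpow_neg_one]
  · rw [if_neg hpj] at h2
    exact qSerre_commute_of_commute h1 h2

theorem E_mul_commutator_F (hij : i + 2 ≤ j ∨ j + 2 ≤ i) :
    E p * (F i * F j - F j * F i) = (F i * F j - F j * F i) * E p := by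
  have hne : i ≠ j := by omega
  wlog hpj : p ≠ j generalizing i j
  · have := this hj hj' hi hi' hij.symm hne.symm (by omega)
    rw [← neg_sub, mul_neg, this, neg_mul]
  have h1 := h.EF p hp hp' i hi hi'
  have h2 := h.EF p hp hp' j hj hj'
  rw [if_neg hpj] at h2
  rcases eq_or_ne p i with rfl | hpi
  · rw [if_pos rfl] at h1
    refine commutator_commute h1 h2 ?_ ?_
    · rw [h.k_mul_F hq hp hp' hj hj', cartan_far hij, zpow_zero, one_smul]
    · rw [h.l_mul_F hq hp hp' hj hj', cartan_far hij, zpow_zero, one_smul]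
  · rw [if_neg hpi] at h1
    have hi : Commute (E p) (F i) := sub_eq_zero.1 h1
    have hj : Commute (E p) (F j) := sub_eq_zero.1 h2
    exact ((hi.mul_right hj).sub_right (hj.mul_right hi)).eq

theorem F_mul_commutator_E (hij : i + 2 ≤ j ∨ j + 2 ≤ i) :
    F p * (E i * E j - E j * E i) = (E i * E j - E j * E i) * F p := by
  have hne : i ≠ j := by omega
  wlog hpj : p ≠ j generalizing i j
  · have := this hj hj' hi hi' hij.symm hne.symm (by omega)
    rw [← neg_sub, mul_neg, this, neg_mul]
  have h1 := h.FE hp hp' hi hi'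
  have h2 := h.FE hp hp' hj hj'
  rw [if_neg hpj] at h2
  rcases eq_or_ne p i with rfl | hpi
  · rw [if_pos rfl] at h1
    refine commutator_commute h1 h2 ?_ ?_
    · rw [h.k_mul_E hq hp hp' hj hj', cartan_far hij, zpow_zero, one_smul]
    · rw [h.l_mul_E hq hp hp' hj hj', cartan_far hij, zpow_zero, one_smul]
  · rw [if_neg hpi] at h1
    have hi : Commute (F p) (E i) := sub_eq_zero.1 h1
    have hj : Commute (F p) (E j) := sub_eq_zero.1 h2
    exact ((hi.mul_right hj).sub_right (hj.mul_right hi)).eq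

end CommuteSerre

end GlCore

end Relations

end QG
namespace QG

section Coproduct

variable {A : Type*} [Ring A] [Algebra ℂ A]

omit [Algebra ℂ A] in
theorem commutator_add {a b a' b' : A} (hab : Commute a' b) (hba : Commute b' a)
    (h : a * b - b * a = 0) (h' : a' * b' - b' * a' = 0) :
    (a + a') * (b + b') - (b + b') * (a + a') = 0 := by
  have h1 : Commute a b := sub_eq_zero.1 h
  have h2 : Commute a' b' := sub_eq_zero.1 h'
  exact sub_eq_zero.2 ((h1.add_right hba.symm).add_left (hab.add_right h2)).eq

omit [Algebra ℂ A] in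
theorem commutator_mul_right {a b k l : A} (hkb : Commute k b) (hla : Commute l a)
    (hkl : Commute k l) (h : a * b - b * a = 0) :
    (a * k) * (b * l) - (b * l) * (a * k) = 0 := by
  have h1 : Commute a b := sub_eq_zero.1 h
  exact sub_eq_zero.2 ((h1.mul_right hla.symm).mul_left (hkb.mul_right hkl)).eq

theorem coproduct_bracket {e f e' f' k' l h h' : A} {t : ℂ} (hef : e * f - f * e = h)
    (hef' : e' * f' - f' * e' = h') (hk : k' * f' = t • (f' * k')) (hl : l * e = t • (e * l))
    (hef'' : Commute e f') (hfe' : Commute f e') (hfk : Commute f k')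
    (hle : Commute l e') (hlk : Commute l k') :
    (e * k' + e') * (f + f' * l) - (f + f' * l) * (e * k' + e') = h * k' + h' * l := by
  have h1 : e * k' * f = e * f * k' := by rw [mul_assoc, ← hfk.eq, mul_assoc]
  have h2 : e * k' * (f' * l) = f' * l * (e * k') := by
    have h3 : e * k' * (f' * l) = t • (f' * e * (l * k')) := by
      rw [mul_assoc, ← mul_assoc k', hk, smul_mul_assoc, mul_smul_comm, mul_assoc f',
        ← hlk.eq, ← mul_assoc, hef''.eq]
    rw [h3, mul_assoc f' l, ← mul_assoc l, hl, smul_mul_assoc, mul_smul_comm]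
    simp only [mul_assoc]
  have h4 : e' * (f' * l) = e' * f' * l := (mul_assoc _ _ _).symm
  have h5 : f' * l * e' = f' * e' * l := by rw [mul_assoc, hle.eq, mul_assoc]
  rw [← hef, ← hef']
  simp only [mul_add, add_mul, sub_mul]
  rw [h1, h2, h4, h5, hfe'.eq]
  simp only [mul_assoc]
  abel

/-- The images of the generators indexed by `D`. -/
def glGens (D : Set ℕ) (K Ki E F : ℕ → A) : Set A :=
  {x | ∃ i ∈ D, x = K i ∨ x = Ki i ∨ (i + 1 ∈ D ∧ (x = E i ∨ x = F i))}

/-- Two commuting families satisfying the relations of `U_q(gl)` are combined by the coproduct. -/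
theorem GlRel.coproduct {q : ℂ} (hq : q ≠ 0) {D : Set ℕ} {K Ki E F K' Ki' E' F' : ℕ → A}
    (h : GlRel q D K Ki E F) (h' : GlRel q D K' Ki' E' F')
    (hc : ∀ x ∈ glGens D K Ki E F, ∀ y ∈ glGens D K' Ki' E' F', Commute x y) :
    GlRel q D (fun i => K i * K' i) (fun i => Ki i * Ki' i)
      (fun j => E j * (K' j * Ki' (j + 1)) + E' j)
      (fun j => F j + F' j * (Ki j * K (j + 1))) := by
  have gK : ∀ i ∈ D, K i ∈ glGens D K Ki E F := fun i hi => ⟨i, hi, .inl rfl⟩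
  have gKi : ∀ i ∈ D, Ki i ∈ glGens D K Ki E F := fun i hi => ⟨i, hi, .inr (.inl rfl)⟩
  have gE : ∀ i ∈ D, i + 1 ∈ D → E i ∈ glGens D K Ki E F :=
    fun i hi hi' => ⟨i, hi, .inr (.inr ⟨hi', .inl rfl⟩)⟩
  have gF : ∀ i ∈ D, i + 1 ∈ D → F i ∈ glGens D K Ki E F :=
    fun i hi hi' => ⟨i, hi, .inr (.inr ⟨hi', .inr rfl⟩)⟩
  have gK' : ∀ i ∈ D, K' i ∈ glGens D K' Ki' E' F' := fun i hi => ⟨i, hi, .inl rfl⟩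
  have gKi' : ∀ i ∈ D, Ki' i ∈ glGens D K' Ki' E' F' := fun i hi => ⟨i, hi, .inr (.inl rfl)⟩
  have gE' : ∀ i ∈ D, i + 1 ∈ D → E' i ∈ glGens D K' Ki' E' F' :=
    fun i hi hi' => ⟨i, hi, .inr (.inr ⟨hi', .inl rfl⟩)⟩
  have gF' : ∀ i ∈ D, i + 1 ∈ D → F' i ∈ glGens D K' Ki' E' F' :=
    fun i hi hi' => ⟨i, hi, .inr (.inr ⟨hi', .inr rfl⟩)⟩
  have hk' : ∀ i ∈ D, i + 1 ∈ D → ∀ x ∈ glGens D K Ki E F, Commute x (K' i * Ki' (i + 1)) :=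
    fun i hi hi' x hx => (hc x hx _ (gK' i hi)).mul_right (hc x hx _ (gKi' _ hi'))
  have hl : ∀ i ∈ D, i + 1 ∈ D → ∀ y ∈ glGens D K' Ki' E' F', Commute (Ki i * K (i + 1)) y :=
    fun i hi hi' y hy => (hc _ (gKi i hi) y hy).mul_left (hc _ (gK _ hi') y hy)
  have hkk' : ∀ i ∈ D, i + 1 ∈ D → ∀ j ∈ D, j + 1 ∈ D →
      Commute (K' i * Ki' (i + 1)) (K' j * Ki' (j + 1)) := fun i hi hi' j hj hj' =>
    ((h'.commute_K_K hi hj).mul_right (h'.commute_K_Ki hi hj')).mul_left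
      ((h'.commute_Ki_K hi' hj).mul_right (h'.commute_Ki_Ki hi' hj'))
  have hll : ∀ i ∈ D, i + 1 ∈ D → ∀ j ∈ D, j + 1 ∈ D →
      Commute (Ki i * K (i + 1)) (Ki j * K (j + 1)) := fun i hi hi' j hj hj' =>
    ((h.commute_Ki_Ki hi hj).mul_right (h.commute_Ki_K hi hj')).mul_left
      ((h.commute_K_Ki hi' hj).mul_right (h.commute_K_K hi' hj'))
  have hEE : ∀ i ∈ D, i + 1 ∈ D → ∀ j ∈ D, j + 1 ∈ D →
      E' i * (E j * (K' j * Ki' (j + 1))) =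
        (q⁻¹) ^ cartan i j • (E j * (K' j * Ki' (j + 1)) * E' i) := fun i hi hi' j hj hj' => by
    rw [mul_assoc, h'.k_mul_E hq hj hj' hi hi', mul_smul_comm, smul_smul, cartan_symm j i, inv_zpow,
      inv_mul_cancel₀ (zpow_ne_zero _ hq), one_smul, (hc _ (gE j hj hj') _ (gE' i hi hi')).left_comm]
  have hFF : ∀ i ∈ D, i + 1 ∈ D → ∀ j ∈ D, j + 1 ∈ D →
      F' i * (Ki i * K (i + 1)) * F j =
        q ^ cartan i j • (F j * (F' i * (Ki i * K (i + 1)))) := fun i hi hi' j hj hj' => by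
    rw [mul_assoc, h.l_mul_F hq hi hi' hj hj', mul_smul_comm,
      (hc _ (gF j hj hj') _ (gF' i hi hi')).symm.left_comm]
  refine ⟨⟨?_, ?_, ?_, ?_, ?_, ?_⟩, ?_, ?_, ?_, ?_⟩
  · intro i hi j hj
    exact (((h.commute_K_K hi hj).mul_right (hc _ (gK i hi) _ (gK' j hj))).mul_left
      ((hc _ (gK j hj) _ (gK' i hi)).symm.mul_right (h'.commute_K_K hi hj))).eq
  · intro i hi
    rw [mul_assoc, (hc _ (gKi i hi) _ (gK' i hi)).symm.left_comm, h'.KKi i hi, mul_one,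
      h.KKi i hi]
  · intro i hi
    rw [mul_assoc, (hc _ (gK i hi) _ (gKi' i hi)).symm.left_comm, h'.KiK i hi, mul_one,
      h.KiK i hi]
  · intro i hi j hj hj'
    have hKk : Commute (K' i) (K' j * Ki' (j + 1)) :=
      (h'.commute_K_K hi hj).mul_right (h'.commute_K_Ki hi hj')
    have h1 : K i * K' i * E j =
        q ^ (kd i j - kd i (j + 1)) • (E j * (K i * K' i)) := by
      rw [mul_assoc, ← (hc _ (gE j hj hj') _ (gK' i hi)).eq, ← mul_assoc, h.KE i hi j hj hj',
        smul_mul_assoc, mul_assoc]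
    have h2 : K i * K' i * E' j =
        q ^ (kd i j - kd i (j + 1)) • (E' j * (K i * K' i)) := by
      rw [mul_assoc, h'.KE i hi j hj hj', mul_smul_comm,
        (hc _ (gK i hi) _ (gE' j hj hj')).left_comm]
    have h3 : Commute (K i * K' i) (K' j * Ki' (j + 1)) :=
      (hk' j hj hj' _ (gK i hi)).mul_left hKk
    rw [mul_add, h2, ← mul_assoc, h1, smul_mul_assoc, mul_assoc, h3.eq, add_mul, smul_add]
    simp only [mul_assoc]
  · intro i hi j hj hj'
    have hKl : Commute (K i) (Ki j * K (j + 1)) :=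
      (h.commute_K_Ki hi hj).mul_right (h.commute_K_K hi hj')
    have h1 : K i * K' i * F j =
        q ^ (kd i (j + 1) - kd i j) • (F j * (K i * K' i)) := by
      rw [mul_assoc, ← (hc _ (gF j hj hj') _ (gK' i hi)).eq, ← mul_assoc, h.KF i hi j hj hj',
        smul_mul_assoc, mul_assoc]
    have h2 : K i * K' i * F' j =
        q ^ (kd i (j + 1) - kd i j) • (F' j * (K i * K' i)) := by
      rw [mul_assoc, h'.KF i hi j hj hj', mul_smul_comm,
        (hc _ (gK i hi) _ (gF' j hj hj')).left_comm]
    have h3 : Commute (K i * K' i) (Ki j * K (j + 1)) :=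
      hKl.mul_left (hl j hj hj' _ (gK' i hi)).symm
    rw [mul_add, h1, ← mul_assoc (K i * K' i), h2, smul_mul_assoc, mul_assoc, h3.eq, add_mul, smul_add]
    simp only [mul_assoc]
  · intro i hi hi' j hj hj'
    rw [coproduct_bracket (h.EF i hi hi' j hj hj') (h'.EF i hi hi' j hj hj')
      (h'.k_mul_F hq hi hi' hj hj')
      (by rw [h.l_mul_E hq hj hj' hi hi', cartan_symm])
      (hc _ (gE i hi hi') _ (gF' j hj hj'))
      (hc _ (gF j hj hj') _ (gE' i hi hi')) (hk' i hi hi' _ (gF j hj hj'))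
      (hl j hj hj' _ (gE' i hi hi'))
      (hk' i hi hi' _ (gKi j hj) |>.mul_left (hk' i hi hi' _ (gK _ hj')))]
    split_ifs with hij
    · subst hij
      have e1 : K i * K' i * (Ki (i + 1) * Ki' (i + 1)) =
          K i * Ki (i + 1) * (K' i * Ki' (i + 1)) :=
        (hc _ (gKi _ hi') _ (gK' i hi)).symm.mul_mul_mul_comm _ _
      have e2 : Ki i * Ki' i * (K (i + 1) * K' (i + 1)) =
          Ki i * K (i + 1) * (Ki' i * K' (i + 1)) :=
        (hc _ (gK _ hi') _ (gKi' i hi)).symm.mul_mul_mul_comm _ _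
      have e3 : (Ki' i * K' (i + 1)) * (Ki i * K (i + 1)) =
          Ki i * K (i + 1) * (Ki' i * K' (i + 1)) :=
        ((hl i hi hi' _ (gKi' i hi)).mul_right (hl i hi hi' _ (gK' _ hi'))).symm.eq
      have e4 : (K' i * Ki' (i + 1)) * (Ki i * K (i + 1)) =
          Ki i * K (i + 1) * (K' i * Ki' (i + 1)) :=
        ((hl i hi hi' _ (gK' i hi)).mul_right (hl i hi hi' _ (gKi' _ hi'))).symm.eq
      rw [e1, e2, smul_mul_assoc, smul_mul_assoc, sub_mul, sub_mul, e3, e4]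
      module
    · simp
  · intro i hi hi' j hj hj' hij
    have hne := cartan_far hij
    refine commutator_add ?_ ?_ ?_ (h'.EE i hi hi' j hj hj' hij)
    · have := hEE i hi hi' j hj hj'
      rwa [hne, zpow_zero, one_smul] at this
    · have := hEE j hj hj' i hi hi'
      rwa [cartan_symm, hne, zpow_zero, one_smul] at this
    · exact commutator_mul_right (hk' i hi hi' _ (gE j hj hj')).symm
        (hk' j hj hj' _ (gE i hi hi')).symm (hkk' i hi hi' j hj hj') (h.EE i hi hi' j hj hj' hij)
  · intro i hi hi' j hj hj' hij
    have hne := cartan_far hij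
    refine commutator_add ?_ ?_ (h.FF i hi hi' j hj hj' hij) ?_
    · have := hFF i hi hi' j hj hj'
      rwa [hne, zpow_zero, one_smul] at this
    · have := hFF j hj hj' i hi hi'
      rwa [cartan_symm, hne, zpow_zero, one_smul] at this
    · exact commutator_mul_right (hl i hi hi' _ (gF' j hj hj'))
        (hl j hj hj' _ (gF' i hi hi')) (hll i hi hi' j hj hj') (h'.FF i hi hi' j hj hj' hij)
  · intro i hi hi' j hj hj' hij
    rw [← qSerre_inv]
    refine qSerre_add (inv_ne_zero hq) ?_ ?_ ?_ ?_ ?_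
    · rw [hEE i hi hi' i hi hi', cartan_self, zpow_ofNat]
    · rw [hEE i hi hi' j hj hj', cartan_near hij, zpow_neg_one]
    · rw [hEE j hj hj' i hi hi', cartan_near hij.symm, zpow_neg_one]
    · rw [qSerre_inv, qSerre_mul_right (hk' i hi hi' _ (gE i hi hi')).symm
        (hk' i hi hi' _ (gE j hj hj')).symm (hk' j hj hj' _ (gE i hi hi')).symm
        (hkk' i hi hi' j hj hj'), h.Eserre i hi hi' j hj hj' hij, zero_mul]
    · rw [qSerre_inv, h'.Eserre i hi hi' j hj hj' hij]
  · intro i hi hi' j hj hj' hij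
    refine qSerre_add hq ?_ ?_ ?_ (h.Fserre i hi hi' j hj hj' hij) ?_
    · rw [hFF i hi hi' i hi hi', cartan_self, zpow_ofNat]
    · rw [hFF i hi hi' j hj hj', cartan_near hij, zpow_neg_one]
    · rw [hFF j hj hj' i hi hi', cartan_near hij.symm, zpow_neg_one]
    · rw [qSerre_mul_right (hl i hi hi' _ (gF' i hi hi')) (hl i hi hi' _ (gF' j hj hj'))
        (hl j hj hj' _ (gF' i hi hi')) (hll i hi hi' j hj hj'),
        h'.Fserre i hi hi' j hj hj' hij, zero_mul]

end Coproduct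

end QG
namespace QG

section Presentation

variable {q : ℝ} {m : ℕ}

open scoped Classical in
/-- Values on the generators, with `1` or `0` outside the index range of `U_q(gl(m))`. -/
noncomputable def genValue (m : ℕ) {A : Type*} [Ring A] (K Ki E F : ℕ → A) : Gen → A
  | .K i => if i ∈ Set.Icc 1 m then K i else 1
  | .Ki i => if i ∈ Set.Icc 1 m then Ki i else 1
  | .E j => if j ∈ Set.Icc 1 m ∧ j + 1 ∈ Set.Icc 1 m then E j else 0
  | .F j => if j ∈ Set.Icc 1 m ∧ j + 1 ∈ Set.Icc 1 m then F j else 0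

theorem GlRel.exists_lift {A : Type*} [Ring A] [Algebra ℂ A] {K Ki E F : ℕ → A}
    (h : GlRel (q : ℂ) (Set.Icc 1 m) K Ki E F) :
    ∃ φ : Uq q m →ₐ[ℂ] A,
      (∀ i, 1 ≤ i → i ≤ m → φ (uK q m i) = K i ∧ φ (uKi q m i) = Ki i) ∧
      (∀ j, 1 ≤ j → j + 1 ≤ m → φ (uE q m j) = E j ∧ φ (uF q m j) = F j) := by
  classical
  let f : FA →ₐ[ℂ] A := FreeAlgebra.lift ℂ (genValue m K Ki E F)
  have fK_in : ∀ i, 1 ≤ i → i ≤ m → f (fK i) = K i := fun i h1 h2 => by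
    simp [f, fK, genValue, h1, h2]
  have fKi_in : ∀ i, 1 ≤ i → i ≤ m → f (fKi i) = Ki i := fun i h1 h2 => by
    simp [f, fKi, genValue, h1, h2]
  have fE_in : ∀ i, 1 ≤ i → i + 1 ≤ m → f (fE i) = E i := fun i h1 h2 => by
    simp [f, fE, genValue, h1, h2, (Nat.le_succ i).trans h2]
  have fF_in : ∀ i, 1 ≤ i → i + 1 ≤ m → f (fF i) = F i := fun i h1 h2 => by
    simp [f, fF, genValue, h1, h2, (Nat.le_succ i).trans h2]
  have fK_out : ∀ i, ¬(1 ≤ i ∧ i ≤ m) → f (fK i) = 1 := fun i h1 => by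
    simp only [f, fK, genValue, FreeAlgebra.lift_ι_apply, Set.mem_Icc, h1, if_false]
  have fKi_out : ∀ i, ¬(1 ≤ i ∧ i ≤ m) → f (fKi i) = 1 := fun i h1 => by
    simp only [f, fKi, genValue, FreeAlgebra.lift_ι_apply, Set.mem_Icc, h1, if_false]
  have fE_out : ∀ j, ¬(1 ≤ j ∧ j + 1 ≤ m) → f (fE j) = 0 := fun j h1 => by
    simp only [f, fE, genValue, FreeAlgebra.lift_ι_apply, Set.mem_Icc]
    exact if_neg (by omega)
  have fF_out : ∀ j, ¬(1 ≤ j ∧ j + 1 ≤ m) → f (fF j) = 0 := fun j h1 => by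
    simp only [f, fF, genValue, FreeAlgebra.lift_ι_apply, Set.mem_Icc]
    exact if_neg (by omega)
  have node : ∀ {j}, 1 ≤ j → j + 1 ≤ m → j ∈ Set.Icc 1 m ∧ j + 1 ∈ Set.Icc 1 m :=
    fun h1 h2 => ⟨⟨h1, (Nat.le_succ _).trans h2⟩, ⟨Nat.le_add_left _ _, h2⟩⟩
  have hf : ∀ ⦃x y : FA⦄, Rel q m x y → f x = f y := by
    intro x y hxy
    induction hxy with
    | Kout i hi => rw [fK_out i hi, map_one]
    | Kiout i hi => rw [fKi_out i hi, map_one]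
    | Eout i hi => rw [fE_out i hi, map_zero]
    | Fout i hi => rw [fF_out i hi, map_zero]
    | KK i j =>
      rw [map_mul, map_mul]
      by_cases hi : 1 ≤ i ∧ i ≤ m
      · by_cases hj : 1 ≤ j ∧ j ≤ m
        · rw [fK_in i hi.1 hi.2, fK_in j hj.1 hj.2, h.KK i hi j hj]
        · rw [fK_out j hj, one_mul, mul_one]
      · rw [fK_out i hi, one_mul, mul_one]
    | KKi i =>
      rw [map_mul, map_one]
      by_cases hi : 1 ≤ i ∧ i ≤ m
      · rw [fK_in i hi.1 hi.2, fKi_in i hi.1 hi.2, h.KKi i hi]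
      · rw [fK_out i hi, fKi_out i hi, mul_one]
    | KiK i =>
      rw [map_mul, map_one]
      by_cases hi : 1 ≤ i ∧ i ≤ m
      · rw [fK_in i hi.1 hi.2, fKi_in i hi.1 hi.2, h.KiK i hi]
      · rw [fK_out i hi, fKi_out i hi, mul_one]
    | KE i j hi hi' hj hj' =>
      rw [map_smul, map_mul, map_mul, fK_in i hi hi', fE_in j hj hj',
        h.KE i ⟨hi, hi'⟩ j (node hj hj').1 (node hj hj').2]
    | KF i j hi hi' hj hj' =>
      rw [map_smul, map_mul, map_mul, fK_in i hi hi', fF_in j hj hj',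
        h.KF i ⟨hi, hi'⟩ j (node hj hj').1 (node hj hj').2]
    | EF i j hi hi' hj hj' =>
      rw [map_sub, map_mul, map_mul, fE_in i hi hi', fF_in j hj hj',
        h.EF i (node hi hi').1 (node hi hi').2 j (node hj hj').1 (node hj hj').2]
      split_ifs
      · rw [map_smul, map_sub, map_mul, map_mul, fK_in i hi (by omega), fKi_in i hi (by omega),
          fK_in _ (by omega) hi', fKi_in _ (by omega) hi']
      · rw [map_zero]
    | EE i j hi hi' hj hj' hij =>
      rw [map_mul, map_mul, fE_in i hi hi', fE_in j hj hj']
      exact sub_eq_zero.1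
        (h.EE i (node hi hi').1 (node hi hi').2 j (node hj hj').1 (node hj hj').2 hij)
    | FF i j hi hi' hj hj' hij =>
      rw [map_mul, map_mul, fF_in i hi hi', fF_in j hj hj']
      exact sub_eq_zero.1
        (h.FF i (node hi hi').1 (node hi hi').2 j (node hj hj').1 (node hj hj').2 hij)
    | Eserre i j hi hi' hj hj' hij =>
      simp only [map_add, map_sub, map_smul, map_mul, map_pow, map_zero, fE_in i hi hi',
        fE_in j hj hj']
      exact h.Eserre i (node hi hi').1 (node hi hi').2 j (node hj hj').1 (node hj hj').2 hij
    | Fserre i j hi hi' hj hj' hij =>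
      simp only [map_add, map_sub, map_smul, map_mul, map_pow, map_zero, fF_in i hi hi',
        fF_in j hj hj']
      exact h.Fserre i (node hi hi').1 (node hi hi').2 j (node hj hj').1 (node hj hj').2 hij
  have key : ∀ x, RingQuot.liftAlgHom ℂ ⟨f, hf⟩ (RingQuot.mkAlgHom ℂ (Rel q m) x) = f x :=
    fun x => RingQuot.liftAlgHom_mkAlgHom_apply ℂ f hf x
  exact ⟨RingQuot.liftAlgHom ℂ ⟨f, hf⟩,
    fun i h1 h2 => ⟨(key _).trans (fK_in i h1 h2), (key _).trans (fKi_in i h1 h2)⟩,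
    fun i h1 h2 => ⟨(key _).trans (fE_in i h1 h2), (key _).trans (fF_in i h1 h2)⟩⟩

theorem mk_eq_of_rel {x y : FA} (h : Rel q m x y) :
    RingQuot.mkAlgHom ℂ (Rel q m) x = RingQuot.mkAlgHom ℂ (Rel q m) y :=
  RingQuot.mkAlgHom_rel ℂ h

theorem uK_out {i : ℕ} (h : ¬(1 ≤ i ∧ i ≤ m)) : uK q m i = 1 := by
  simpa [uK, uKi, uE, uF] using mk_eq_of_rel (.Kout i h)

theorem uKi_out {i : ℕ} (h : ¬(1 ≤ i ∧ i ≤ m)) : uKi q m i = 1 := by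
  simpa [uK, uKi, uE, uF] using mk_eq_of_rel (.Kiout i h)

theorem uE_out {i : ℕ} (h : ¬(1 ≤ i ∧ i + 1 ≤ m)) : uE q m i = 0 := by
  simpa [uK, uKi, uE, uF] using mk_eq_of_rel (.Eout i h)

theorem uF_out {i : ℕ} (h : ¬(1 ≤ i ∧ i + 1 ≤ m)) : uF q m i = 0 := by
  simpa [uK, uKi, uE, uF] using mk_eq_of_rel (.Fout i h)

theorem uK_mul_uK (i j : ℕ) : uK q m i * uK q m j = uK q m j * uK q m i := by
  simpa [uK, uKi, uE, uF] using mk_eq_of_rel (q := q) (m := m) (.KK i j)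

theorem uK_mul_uKi (i : ℕ) : uK q m i * uKi q m i = 1 := by
  simpa [uK, uKi, uE, uF] using mk_eq_of_rel (q := q) (m := m) (.KKi i)

theorem uKi_mul_uK (i : ℕ) : uKi q m i * uK q m i = 1 := by
  simpa [uK, uKi, uE, uF] using mk_eq_of_rel (q := q) (m := m) (.KiK i)

theorem uK_mul_uE (i j : ℕ) :
    uK q m i * uE q m j = (q : ℂ) ^ (kd i j - kd i (j + 1)) • (uE q m j * uK q m i) := by
  by_cases hj : 1 ≤ j ∧ j + 1 ≤ m
  · by_cases hi : 1 ≤ i ∧ i ≤ m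
    · simpa [uK, uKi, uE, uF] using mk_eq_of_rel (q := q) (.KE i j hi.1 hi.2 hj.1 hj.2)
    · have h1 : i ≠ j := by omega
      have h2 : i ≠ j + 1 := by omega
      simp [uK_out hi, kd, h1, h2]
  · simp [uE_out hj]

theorem uK_mul_uF (i j : ℕ) :
    uK q m i * uF q m j = (q : ℂ) ^ (kd i (j + 1) - kd i j) • (uF q m j * uK q m i) := by
  by_cases hj : 1 ≤ j ∧ j + 1 ≤ m
  · by_cases hi : 1 ≤ i ∧ i ≤ m
    · simpa [uK, uKi, uE, uF] using mk_eq_of_rel (q := q) (.KF i j hi.1 hi.2 hj.1 hj.2)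
    · have h1 : i ≠ j := by omega
      have h2 : i ≠ j + 1 := by omega
      simp [uK_out hi, kd, h1, h2]
  · simp [uF_out hj]

theorem uE_commutator_uF {i : ℕ} (hi : 1 ≤ i) (him : i ≠ m) (j : ℕ) :
    uE q m i * uF q m j - uF q m j * uE q m i = if i = j then
      ((q : ℂ) - (q : ℂ)⁻¹)⁻¹ • (uK q m i * uKi q m (i + 1) - uKi q m i * uK q m (i + 1))
      else 0 := by
  by_cases hi' : i + 1 ≤ m
  · by_cases hj : 1 ≤ j ∧ j + 1 ≤ m
    · have := mk_eq_of_rel (q := q) (.EF i j hi hi' hj.1 hj.2)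
      split_ifs at this ⊢ <;> simpa [uK, uKi, uE, uF] using this
    · have h1 : i ≠ j := by omega
      simp [uF_out hj, h1]
  · rw [uE_out (by omega), uK_out (i := i) (by omega), uK_out (by omega),
      uKi_out (i := i) (by omega), uKi_out (by omega)]
    simp

theorem uE_commutator_uE {i j : ℕ} (hij : i + 2 ≤ j ∨ j + 2 ≤ i) :
    uE q m i * uE q m j - uE q m j * uE q m i = 0 := by
  by_cases hi : 1 ≤ i ∧ i + 1 ≤ m
  · by_cases hj : 1 ≤ j ∧ j + 1 ≤ m
    · rw [sub_eq_zero]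
      simpa [uK, uKi, uE, uF] using mk_eq_of_rel (q := q) (.EE i j hi.1 hi.2 hj.1 hj.2 hij)
    · simp [uE_out hj]
  · simp [uE_out hi]

theorem uF_commutator_uF {i j : ℕ} (hij : i + 2 ≤ j ∨ j + 2 ≤ i) :
    uF q m i * uF q m j - uF q m j * uF q m i = 0 := by
  by_cases hi : 1 ≤ i ∧ i + 1 ≤ m
  · by_cases hj : 1 ≤ j ∧ j + 1 ≤ m
    · rw [sub_eq_zero]
      simpa [uK, uKi, uE, uF] using mk_eq_of_rel (q := q) (.FF i j hi.1 hi.2 hj.1 hj.2 hij)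
    · simp [uF_out hj]
  · simp [uF_out hi]

theorem qSerre_uE {i j : ℕ} (hij : i + 1 = j ∨ j + 1 = i) :
    qSerre (q : ℂ) (uE q m i) (uE q m j) = 0 := by
  by_cases hi : 1 ≤ i ∧ i + 1 ≤ m
  · by_cases hj : 1 ≤ j ∧ j + 1 ≤ m
    · simpa only [map_add, map_sub, map_smul, map_mul, map_pow, map_zero, qSerre, uE,
      uF] using
        mk_eq_of_rel (q := q) (.Eserre i j hi.1 hi.2 hj.1 hj.2 hij)
    · simp [uE_out hj, qSerre]
  · simp [uE_out hi, qSerre]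

theorem qSerre_uF {i j : ℕ} (hij : i + 1 = j ∨ j + 1 = i) :
    qSerre (q : ℂ) (uF q m i) (uF q m j) = 0 := by
  by_cases hi : 1 ≤ i ∧ i + 1 ≤ m
  · by_cases hj : 1 ≤ j ∧ j + 1 ≤ m
    · simpa only [map_add, map_sub, map_smul, map_mul, map_pow, map_zero, qSerre, uE,
      uF] using
        mk_eq_of_rel (q := q) (.Fserre i j hi.1 hi.2 hj.1 hj.2 hij)
    · simp [uF_out hj, qSerre]
  · simp [uF_out hi, qSerre]

theorem Uq.induction {p : Uq q m → Prop} (hK : ∀ i, 1 ≤ i → i ≤ m → p (uK q m i))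
    (hKi : ∀ i, 1 ≤ i → i ≤ m → p (uKi q m i)) (hE : ∀ i, 1 ≤ i → i + 1 ≤ m → p (uE q m i))
    (hF : ∀ i, 1 ≤ i → i + 1 ≤ m → p (uF q m i)) (hc : ∀ c, p (algebraMap ℂ _ c))
    (hadd : ∀ x y, p x → p y → p (x + y)) (hmul : ∀ x y, p x → p y → p (x * y)) (x : Uq q m) :
    p x := by
  obtain ⟨x, rfl⟩ := RingQuot.mkAlgHom_surjective ℂ (Rel q m) x
  have h1 : p 1 := by simpa using hc 1
  have h0 : p 0 := by simpa using hc 0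
  induction x using FreeAlgebra.induction with
  | grade0 c => simpa using hc c
  | grade1 g =>
    cases g with
    | K i =>
      by_cases hi : 1 ≤ i ∧ i ≤ m
      · exact hK i hi.1 hi.2
      · have h := uK_out (q := q) hi
        exact (congrArg p h).mpr h1
    | Ki i =>
      by_cases hi : 1 ≤ i ∧ i ≤ m
      · exact hKi i hi.1 hi.2
      · have h := uKi_out (q := q) hi
        exact (congrArg p h).mpr h1
    | E i =>
      by_cases hi : 1 ≤ i ∧ i + 1 ≤ m
      · exact hE i hi.1 hi.2
      · have h := uE_out (q := q) hi
        exact (congrArg p h).mpr h0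
    | F i =>
      by_cases hi : 1 ≤ i ∧ i + 1 ≤ m
      · exact hF i hi.1 hi.2
      · have h := uF_out (q := q) hi
        exact (congrArg p h).mpr h0
  | mul a b ha hb => rw [map_mul]; exact hmul _ _ ha hb
  | add a b ha hb => rw [map_add]; exact hadd _ _ ha hb

end Presentation

end QG
namespace QG

noncomputable section Words

variable {N : Type*} [AddCommGroup N] [Module ℂ N]

/-- The tensor product of the free algebra on the lowering operators with `N`. -/
abbrev Words (N : Type*) [AddCommGroup N] := List ℕ →₀ N

/-- Left multiplication by a lowering generator. -/
def lower (j : ℕ) : Module.End ℂ (Words N) := Finsupp.lmapDomain N ℂ (List.cons j)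

/-- The operator acting on `w ⊗ v` as `t` on `v` and by the weight of the word `w`. -/
def diag (a : ℕ → ℂ) (t : Module.End ℂ N) : Module.End ℂ (Words N) :=
  Finsupp.lsum ℂ fun w : List ℕ => (w.map a).prod • (Finsupp.lsingle w ∘ₗ t)

/-- The value of `raise t h` on the words `w ⊗ v`. -/
def raiseWord (t : Module.End ℂ N) (h : ℕ → Module.End ℂ (Words N)) : List ℕ → N →ₗ[ℂ] Words N
  | [] => Finsupp.lsingle [] ∘ₗ t
  | j :: w => lower j ∘ₗ raiseWord t h w + h j ∘ₗ Finsupp.lsingle w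

/-- The operator extending `t` whose commutator with `lower j` is `h j`. -/
def raise (t : Module.End ℂ N) (h : ℕ → Module.End ℂ (Words N)) : Module.End ℂ (Words N) :=
  Finsupp.lsum ℂ (raiseWord t h)

@[simp]
theorem lower_single (j : ℕ) (w : List ℕ) (v : N) :
    lower j (Finsupp.single w v) = Finsupp.single (j :: w) v := by
  simp [lower]

@[simp]
theorem diag_single (a : ℕ → ℂ) (t : Module.End ℂ N) (w : List ℕ) (v : N) :
    diag a t (Finsupp.single w v) = (w.map a).prod • Finsupp.single w (t v) := by
  simp [diag]

@[simp]
theorem raise_single (t : Module.End ℂ N) (h : ℕ → Module.End ℂ (Words N)) (w : List ℕ) (v : N) :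
    raise t h (Finsupp.single w v) = raiseWord t h w v := by
  simp [raise]

theorem raise_single_nil (t : Module.End ℂ N) (h : ℕ → Module.End ℂ (Words N)) (v : N) :
    raise t h (Finsupp.single [] v) = Finsupp.single [] (t v) := by
  simp [raiseWord]

theorem diag_mul_lower (a : ℕ → ℂ) (t : Module.End ℂ N) (j : ℕ) :
    diag a t * lower j = a j • (lower j * diag a t) := by
  ext w v : 2
  simp [mul_smul]

theorem diag_mul_diag (a b : ℕ → ℂ) (s t : Module.End ℂ N) :
    diag a s * diag b t = diag (a * b) (s * t) := by
  ext w v : 2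
  simp [smul_smul, Pi.mul_def]

theorem diag_one : diag (1 : ℕ → ℂ) (1 : Module.End ℂ N) = 1 := by
  ext w v : 2
  simp [Pi.one_def]

theorem raise_commutator_lower (t : Module.End ℂ N) (h : ℕ → Module.End ℂ (Words N)) (j : ℕ) :
    raise t h * lower j - lower j * raise t h = h j := by
  ext w v : 2
  simp [raiseWord]

theorem words_hom_ext {V : Type*} [AddCommGroup V] [Module ℂ V] {S T : Words N →ₗ[ℂ] V}
    (hnil : ∀ v, S (Finsupp.single [] v) = T (Finsupp.single [] v))
    (hlower : ∀ j x, S x = T x → S (lower j x) = T (lower j x)) : S = T := by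
  ext1 w
  ext1 v
  simp only [LinearMap.comp_apply, Finsupp.lsingle_apply]
  induction w with
  | nil => exact hnil v
  | cons j w ih => simpa using hlower j _ ih

/-- Relations of the upper Borel subalgebra of `U_q(gl_∞)` for operators on `N`. -/
structure BorelRel (q : ℂ) (κ κi ε : ℕ → Module.End ℂ N) : Prop where
  KK : ∀ i j, κ i * κ j = κ j * κ i
  KKi : ∀ i, κ i * κi i = 1
  KiK : ∀ i, κi i * κ i = 1
  KE : ∀ i j, κ i * ε j = q ^ (kd i j - kd i (j + 1)) • (ε j * κ i)
  EE : ∀ i j, (i + 2 ≤ j ∨ j + 2 ≤ i) → ε i * ε j - ε j * ε i = 0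
  Eserre : ∀ i j, (i + 1 = j ∨ j + 1 = i) → qSerre q (ε i) (ε j) = 0

/-- The eigenvalues of `K_i` under commutation with the lowering operators. -/
def lowerWeight (q : ℂ) (i : ℕ) (j : ℕ) : ℂ := q ^ (kd i (j + 1) - kd i j)

def wordK (q : ℂ) (κ : ℕ → Module.End ℂ N) (i : ℕ) : Module.End ℂ (Words N) :=
  diag (lowerWeight q i) (κ i)

def wordKi (q : ℂ) (κi : ℕ → Module.End ℂ N) (i : ℕ) : Module.End ℂ (Words N) :=
  diag (lowerWeight q i)⁻¹ (κi i)

def wordBracket (q : ℂ) (κ κi : ℕ → Module.End ℂ N) (i : ℕ) : Module.End ℂ (Words N) :=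
  (q - q⁻¹)⁻¹ • (wordK q κ i * wordKi q κi (i + 1) - wordKi q κi i * wordK q κ (i + 1))

def wordE (q : ℂ) (κ κi ε : ℕ → Module.End ℂ N) (i : ℕ) : Module.End ℂ (Words N) :=
  raise (ε i) fun j => if i = j then wordBracket q κ κi i else 0

theorem lowerWeight_ne_zero {q : ℂ} (hq : q ≠ 0) (i : ℕ) (j : ℕ) : lowerWeight q i j ≠ 0 :=
  zpow_ne_zero _ hq

variable {q : ℂ} {κ κi ε : ℕ → Module.End ℂ N}

theorem wordE_single_nil (i : ℕ) (v : N) :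
    wordE q κ κi ε i (Finsupp.single [] v) = Finsupp.single [] (ε i v) :=
  raise_single_nil _ _ v

theorem wordK_single_nil (i : ℕ) (v : N) :
    wordK q κ i (Finsupp.single [] v) = Finsupp.single [] (κ i v) := by
  simp [wordK]

theorem wordK_lower (i j : ℕ) (x : Words N) :
    wordK q κ i (lower j x) = q ^ (kd i (j + 1) - kd i j) • lower j (wordK q κ i x) :=
  LinearMap.congr_fun (diag_mul_lower (lowerWeight q i) (κ i) j) x

theorem BorelRel.wordK_mul_wordK (h : BorelRel q κ κi ε) (i j : ℕ) :
    wordK q κ i * wordK q κ j = wordK q κ j * wordK q κ i := by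
  simp only [wordK, diag_mul_diag, h.KK i j, mul_comm (lowerWeight q i)]

theorem BorelRel.wordK_mul_wordKi (hq : q ≠ 0) (h : BorelRel q κ κi ε) (i : ℕ) :
    wordK q κ i * wordKi q κi i = 1 := by
  rw [wordK, wordKi, diag_mul_diag, h.KKi, ← diag_one]
  congr 1
  ext j
  exact mul_inv_cancel₀ (lowerWeight_ne_zero hq i j)

theorem BorelRel.wordKi_mul_wordK (hq : q ≠ 0) (h : BorelRel q κ κi ε) (i : ℕ) :
    wordKi q κi i * wordK q κ i = 1 := by
  rw [wordK, wordKi, diag_mul_diag, h.KiK, ← diag_one]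
  congr 1
  ext j
  exact inv_mul_cancel₀ (lowerWeight_ne_zero hq i j)

theorem BorelRel.commute_wordK_wordBracket (hq : q ≠ 0) (h : BorelRel q κ κi ε) (i j : ℕ) :
    Commute (wordK q κ i) (wordBracket q κ κi j) := by
  have hK : ∀ i j, Commute (wordK q κ i) (wordK q κ j) := h.wordK_mul_wordK
  have hKi : ∀ i j, Commute (wordK q κ i) (wordKi q κi j) := fun i j =>
    (commute_of_inverse (hK j i) (h.wordK_mul_wordKi hq j) (h.wordKi_mul_wordK hq j)).symm
  exact (((hK _ _).mul_right (hKi _ _)).sub_right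
    ((hKi _ _).mul_right (hK _ _))).smul_right _

theorem wordE_commutator_lower (i j : ℕ) :
    wordE q κ κi ε i * lower j - lower j * wordE q κ κi ε i =
      if i = j then wordBracket q κ κi i else 0 :=
  raise_commutator_lower _ _ j

theorem BorelRel.wordK_mul_wordE (hq : q ≠ 0) (h : BorelRel q κ κi ε) (i j : ℕ) :
    wordK q κ i * wordE q κ κi ε j =
      q ^ (kd i j - kd i (j + 1)) • (wordE q κ κi ε j * wordK q κ i) := by
  refine words_hom_ext (fun v => ?_) fun l x hx => ?_
  · have := LinearMap.congr_fun (h.KE i j) v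
    simp only [Module.End.mul_apply, LinearMap.smul_apply] at this
    simp only [Module.End.mul_apply, LinearMap.smul_apply, wordE_single_nil, wordK_single_nil,
      this, Finsupp.smul_single]
  · have hEl : ∀ y, wordE q κ κi ε j (lower l y) =
        lower l (wordE q κ κi ε j y) + (if j = l then wordBracket q κ κi j else 0) y := fun y => by
      rw [← wordE_commutator_lower (ε := ε)]; simp
    have hb : ∀ y, wordK q κ i (wordBracket q κ κi j y) = wordBracket q κ κi j (wordK q κ i y) :=
      LinearMap.congr_fun (h.commute_wordK_wordBracket hq i j).eq
    simp only [Module.End.mul_apply, LinearMap.smul_apply] at hx ⊢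
    simp only [hEl, map_add, wordK_lower, hx, map_smul]
    split_ifs with hjl
    · subst hjl
      have hone : q ^ (kd i j - kd i (j + 1)) * q ^ (kd i (j + 1) - kd i j) = 1 := by
        rw [← zpow_add₀ hq, ← zpow_zero q]
        congr 1
        ring
      rw [hb, smul_add, smul_add, smul_smul _ _ (wordBracket q κ κi j _), hone, one_smul,
        smul_comm]
    · simp only [LinearMap.zero_apply, map_zero, add_zero]
      rw [smul_comm]

/-- The induced module satisfies all relations of `U_q(gl_∞)` not involving only lowering
operators. -/
theorem BorelRel.glCore (hq : q ≠ 0) (h : BorelRel q κ κi ε) :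
    GlCore q Set.univ (wordK q κ) (wordKi q κi) (wordE q κ κi ε) lower where
  KK i _ j _ := h.wordK_mul_wordK i j
  KKi i _ := h.wordK_mul_wordKi hq i
  KiK i _ := h.wordKi_mul_wordK hq i
  KE i _ j _ _ := h.wordK_mul_wordE hq i j
  KF _ _ j _ _ := diag_mul_lower _ _ j
  EF i _ _ j _ _ := wordE_commutator_lower i j

theorem eq_zero_of_commute_lower {T : Module.End ℂ (Words N)}
    (hnil : ∀ v, T (Finsupp.single [] v) = 0) (hT : ∀ j, lower j * T = T * lower j) : T = 0 := by
  refine words_hom_ext (fun v => by simp [hnil]) fun j x hx => ?_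
  have := LinearMap.congr_fun (hT j) x
  simp only [Module.End.mul_apply] at this
  simp [← this, hx]

theorem BorelRel.wordE_commutator_wordE (hq : q ≠ 0) (h : BorelRel q κ κi ε) {i j : ℕ}
    (hij : i + 2 ≤ j ∨ j + 2 ≤ i) :
    wordE q κ κi ε i * wordE q κ κi ε j - wordE q κ κi ε j * wordE q κ κi ε i = 0 := by
  refine eq_zero_of_commute_lower (fun v => ?_) fun p =>
    (h.glCore hq).F_mul_commutator_E hq trivial trivial trivial trivial trivial trivial hij
  have := LinearMap.congr_fun (h.EE i j hij) v
  simp only [LinearMap.sub_apply, Module.End.mul_apply, LinearMap.zero_apply] at this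
  simp only [LinearMap.sub_apply, Module.End.mul_apply, wordE_single_nil, ← Finsupp.single_sub,
    this, Finsupp.single_zero]

theorem BorelRel.qSerre_wordE (hq : q ≠ 0) (h : BorelRel q κ κi ε) {i j : ℕ}
    (hij : i + 1 = j ∨ j + 1 = i) :
    qSerre q (wordE q κ κi ε i) (wordE q κ κi ε j) = 0 := by
  refine eq_zero_of_commute_lower (fun v => ?_) fun p =>
    (h.glCore hq).F_mul_qSerre_E hq trivial trivial trivial trivial trivial trivial hij
  have := LinearMap.congr_fun (h.Eserre i j hij) v
  simp only [qSerre, pow_two, LinearMap.sub_apply, LinearMap.add_apply, LinearMap.smul_apply,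
    Module.End.mul_apply, LinearMap.zero_apply] at this
  simp only [qSerre, pow_two, LinearMap.sub_apply, LinearMap.add_apply, LinearMap.smul_apply,
    Module.End.mul_apply, wordE_single_nil, Finsupp.smul_single, ← Finsupp.single_sub,
    ← Finsupp.single_add, this, Finsupp.single_zero]

/-- The Serre elements in the lowering operators. -/
def lowerSerre (q : ℂ) (N : Type*) [AddCommGroup N] [Module ℂ N] :
    Set (Module.End ℂ (Words N)) :=
  {S | ∃ i j, ((i + 2 ≤ j ∨ j + 2 ≤ i) ∧ S = lower i * lower j - lower j * lower i) ∨
    ((i + 1 = j ∨ j + 1 = i) ∧ S = qSerre q (lower i) (lower j))}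

/-- The smallest submodule stable under the lowering operators that contains the values of all
Serre elements. -/
def serreSubmodule (q : ℂ) (N : Type*) [AddCommGroup N] [Module ℂ N] : Submodule ℂ (Words N) :=
  sInf {J | (∀ S ∈ lowerSerre q N, ∀ x, S x ∈ J) ∧ ∀ j, ∀ x ∈ J, lower j x ∈ J}

theorem serreSubmodule_le {J : Submodule ℂ (Words N)}
    (hS : ∀ S ∈ lowerSerre q N, ∀ x, S x ∈ J) (hJ : ∀ j, ∀ x ∈ J, lower j x ∈ J) :
    serreSubmodule q N ≤ J :=
  sInf_le ⟨hS, hJ⟩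

theorem serre_mem_serreSubmodule {S : Module.End ℂ (Words N)} (hS : S ∈ lowerSerre q N)
    (x : Words N) : S x ∈ serreSubmodule q N :=
  Submodule.mem_sInf.2 fun _ hJ => hJ.1 S hS x

theorem lower_mem_serreSubmodule (j : ℕ) {x : Words N} (hx : x ∈ serreSubmodule q N) :
    lower j x ∈ serreSubmodule q N :=
  Submodule.mem_sInf.2 fun J hJ => hJ.2 j x (Submodule.mem_sInf.1 hx J hJ)

theorem diag_mem_serreSubmodule (a : ℕ → ℂ) (t : Module.End ℂ N) {x : Words N}
    (hx : x ∈ serreSubmodule q N) : diag a t x ∈ serreSubmodule q N := by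
  refine serreSubmodule_le (J := (serreSubmodule q N).comap (diag a t)) ?_ ?_ hx
  · intro S hS x
    obtain ⟨c, hc⟩ : ∃ c : ℂ, diag a t * S = c • (S * diag a t) := by
      obtain ⟨i, j, ⟨-, rfl⟩ | ⟨-, rfl⟩⟩ := hS
      · exact ⟨_, mul_commutator_comm_smul (diag_mul_lower a t i) (diag_mul_lower a t j)⟩
      · exact ⟨_, mul_qSerre_comm_smul (diag_mul_lower a t i) (diag_mul_lower a t j)⟩
    have : diag a t (S x) = c • S (diag a t x) := LinearMap.congr_fun hc x
    rw [Submodule.mem_comap, this]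
    exact Submodule.smul_mem _ _ (serre_mem_serreSubmodule hS _)
  · intro j x hx
    have : diag a t (lower j x) = a j • lower j (diag a t x) :=
      LinearMap.congr_fun (diag_mul_lower a t j) x
    rw [Submodule.mem_comap, this]
    exact Submodule.smul_mem _ _ (lower_mem_serreSubmodule j hx)

theorem wordBracket_mem_serreSubmodule (i : ℕ) {x : Words N} (hx : x ∈ serreSubmodule q N) :
    wordBracket q κ κi i x ∈ serreSubmodule q N :=
  Submodule.smul_mem _ _ (Submodule.sub_mem _
    (diag_mem_serreSubmodule _ _ (diag_mem_serreSubmodule _ _ hx))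
    (diag_mem_serreSubmodule _ _ (diag_mem_serreSubmodule _ _ hx)))

theorem BorelRel.wordE_mem_serreSubmodule (hq : q ≠ 0) (h : BorelRel q κ κi ε) (i : ℕ)
    {x : Words N} (hx : x ∈ serreSubmodule q N) :
    wordE q κ κi ε i x ∈ serreSubmodule q N := by
  refine (serreSubmodule_le (J := (serreSubmodule q N).comap (wordE q κ κi ε i) ⊓
    serreSubmodule q N) ?_ ?_ hx).1
  · intro S hS x
    refine ⟨?_, serre_mem_serreSubmodule hS x⟩
    have hc : wordE q κ κi ε i * S = S * wordE q κ κi ε i := by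
      obtain ⟨j, l, ⟨hjl, rfl⟩ | ⟨hjl, rfl⟩⟩ := hS
      · exact (h.glCore hq).E_mul_commutator_F hq trivial trivial trivial trivial trivial trivial
          hjl
      · exact (h.glCore hq).E_mul_qSerre_F hq trivial trivial trivial trivial trivial trivial hjl
    have : wordE q κ κi ε i (S x) = S (wordE q κ κi ε i x) := LinearMap.congr_fun hc x
    rw [SetLike.mem_coe, Submodule.mem_comap, this]
    exact serre_mem_serreSubmodule hS _
  · rintro j x ⟨hx, hx'⟩
    refine ⟨?_, lower_mem_serreSubmodule j hx'⟩
    have := LinearMap.congr_fun (sub_eq_iff_eq_add'.1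
      (wordE_commutator_lower (q := q) (κ := κ) (κi := κi) (ε := ε) i j)) x
    simp only [Module.End.mul_apply, LinearMap.add_apply] at this
    rw [SetLike.mem_coe, Submodule.mem_comap, this]
    refine Submodule.add_mem _ (lower_mem_serreSubmodule j hx) ?_
    split_ifs
    · exact wordBracket_mem_serreSubmodule i hx'
    · exact Submodule.zero_mem _

end Words

end QG

namespace QG

section Quotient

variable {W : Type*} [AddCommGroup W] [Module ℂ W] {J : Submodule ℂ W} {q : ℂ} {D : Set ℕ}
  {K Ki E F : ℕ → Module.End ℂ W}

/-- Operators satisfying the relations of `U_q(gl)` up to the Serre relations of the lowering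
operators act on every stable quotient in which the latter hold. -/
theorem GlCore.quotient (h : GlCore q D K Ki E F)
    (hEE : ∀ i j, (i + 2 ≤ j ∨ j + 2 ≤ i) → E i * E j - E j * E i = 0)
    (hEserre : ∀ i j, (i + 1 = j ∨ j + 1 = i) → qSerre q (E i) (E j) = 0)
    (hFF : ∀ i j, (i + 2 ≤ j ∨ j + 2 ≤ i) → ∀ x, (F i * F j - F j * F i) x ∈ J)
    (hFserre : ∀ i j, (i + 1 = j ∨ j + 1 = i) → ∀ x, qSerre q (F i) (F j) x ∈ J)
    (jK : ∀ i, J ≤ J.comap (K i)) (jKi : ∀ i, J ≤ J.comap (Ki i))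
    (jE : ∀ i, J ≤ J.comap (E i)) (jF : ∀ i, J ≤ J.comap (F i)) :
    GlRel q D (fun i => J.mapQ J (K i) (jK i)) (fun i => J.mapQ J (Ki i) (jKi i))
      (fun i => J.mapQ J (E i) (jE i)) (fun i => J.mapQ J (F i) (jF i)) where
  KK i hi j hj := Submodule.linearMap_qext _ <| LinearMap.ext fun x =>
    congrArg J.mkQ (LinearMap.congr_fun (h.KK i hi j hj) x)
  KKi i hi := Submodule.linearMap_qext _ <| LinearMap.ext fun x =>
    congrArg J.mkQ (LinearMap.congr_fun (h.KKi i hi) x)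
  KiK i hi := Submodule.linearMap_qext _ <| LinearMap.ext fun x =>
    congrArg J.mkQ (LinearMap.congr_fun (h.KiK i hi) x)
  KE i hi j hj hj' := Submodule.linearMap_qext _ <| LinearMap.ext fun x =>
    congrArg J.mkQ (LinearMap.congr_fun (h.KE i hi j hj hj') x)
  KF i hi j hj hj' := Submodule.linearMap_qext _ <| LinearMap.ext fun x =>
    congrArg J.mkQ (LinearMap.congr_fun (h.KF i hi j hj hj') x)
  EF i hi hi' j hj hj' := by
    have := h.EF i hi hi' j hj hj'
    split_ifs at this ⊢ <;> exact Submodule.linearMap_qext _ <| LinearMap.ext fun x =>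
      congrArg J.mkQ (LinearMap.congr_fun this x)
  EE i _ _ j _ _ hij := Submodule.linearMap_qext _ <| LinearMap.ext fun x =>
    congrArg J.mkQ (LinearMap.congr_fun (hEE i j hij) x)
  FF i _ _ j _ _ hij := Submodule.linearMap_qext _ <| LinearMap.ext fun x =>
    (Submodule.Quotient.mk_eq_zero J).2 (hFF i j hij x)
  Eserre i _ _ j _ _ hij := Submodule.linearMap_qext _ <| LinearMap.ext fun x => by
    have := congrArg J.mkQ (LinearMap.congr_fun (hEserre i j hij) x)
    simp only [qSerre, pow_two] at this ⊢
    exact this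
  Fserre i _ _ j _ _ hij := Submodule.linearMap_qext _ <| LinearMap.ext fun x => by
    have := (Submodule.Quotient.mk_eq_zero J).2 (hFserre i j hij x)
    simp only [qSerre, pow_two] at this ⊢
    exact this

end Quotient

variable {q : ℝ} {n : ℕ}

theorem borelRel_mulLeft (q : ℝ) (n : ℕ) :
    BorelRel (q : ℂ) (fun i => LinearMap.mulLeft ℂ (uK q n i))
      (fun i => LinearMap.mulLeft ℂ (uKi q n i)) (fun i => LinearMap.mulLeft ℂ (uE q n i)) where
  KK i j := by ext x; simp [← mul_assoc, uK_mul_uK i j]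
  KKi i := by ext x; simp [← mul_assoc, uK_mul_uKi i]
  KiK i := by ext x; simp [← mul_assoc, uKi_mul_uK i]
  KE i j := by ext x; simp [← mul_assoc, uK_mul_uE i j]
  EE i j hij := by ext x; simp [← mul_assoc, ← sub_mul, uE_commutator_uE hij]
  Eserre i j hij := by
    ext x
    have := congrArg (· * x) (qSerre_uE (q := q) (m := n) hij)
    simpa [qSerre, pow_two, mul_assoc, add_mul, sub_mul] using this

/-- The map `w ⊗ u ↦ F_w u` from words with coefficients in `U_q(gl(n))`. -/
noncomputable def wordEval (q : ℝ) (n : ℕ) : Words (Uq q n) →ₗ[ℂ] Uq q n :=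
  Finsupp.lsum ℂ fun w => LinearMap.mulLeft ℂ (w.map (uF q n)).prod

theorem wordEval_single_nil (u : Uq q n) : wordEval q n (Finsupp.single [] u) = u := by
  simp [wordEval]

theorem wordEval_lower (j : ℕ) (x : Words (Uq q n)) :
    wordEval q n (lower j x) = uF q n j * wordEval q n x := by
  suffices h : wordEval q n ∘ₗ lower j = LinearMap.mulLeft ℂ (uF q n j) ∘ₗ wordEval q n from
    LinearMap.congr_fun h x
  ext1 w
  ext1 v
  simp [wordEval]

theorem wordEval_wordK (i : ℕ) (x : Words (Uq q n)) :
    wordEval q n (wordK (q : ℂ) (fun i => LinearMap.mulLeft ℂ (uK q n i)) i x) =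
      uK q n i * wordEval q n x := by
  suffices h : wordEval q n ∘ₗ wordK (q : ℂ) (fun i => LinearMap.mulLeft ℂ (uK q n i)) i =
      LinearMap.mulLeft ℂ (uK q n i) ∘ₗ wordEval q n from LinearMap.congr_fun h x
  refine words_hom_ext (fun v => ?_) fun l x hx => ?_
  · simp only [LinearMap.comp_apply, LinearMap.mulLeft_apply, wordK_single_nil,
      wordEval_single_nil]
  · simp only [LinearMap.comp_apply, LinearMap.mulLeft_apply] at hx ⊢
    rw [wordK_lower, map_smul, wordEval_lower, wordEval_lower, hx, ← mul_assoc, ← mul_assoc,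
      uK_mul_uF,
      smul_mul_assoc]

theorem wordEval_wordKi (hq : (q : ℂ) ≠ 0) (i : ℕ) (x : Words (Uq q n)) :
    wordEval q n (wordKi (q : ℂ) (fun i => LinearMap.mulLeft ℂ (uKi q n i)) i x) =
      uKi q n i * wordEval q n x := by
  have h := LinearMap.congr_fun ((borelRel_mulLeft q n).wordK_mul_wordKi hq i) x
  have h' := wordEval_wordK i (wordKi (q : ℂ) (fun i => LinearMap.mulLeft ℂ (uKi q n i)) i x)
  rw [← Module.End.mul_apply, h, Module.End.one_apply] at h'
  rw [h', ← mul_assoc, uKi_mul_uK, one_mul]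

theorem wordEval_wordE (hq : (q : ℂ) ≠ 0) {i : ℕ} (hi : 1 ≤ i) (hin : i ≠ n)
    (x : Words (Uq q n)) :
    wordEval q n (wordE (q : ℂ) (fun i => LinearMap.mulLeft ℂ (uK q n i))
      (fun i => LinearMap.mulLeft ℂ (uKi q n i)) (fun i => LinearMap.mulLeft ℂ (uE q n i)) i x) =
      uE q n i * wordEval q n x := by
  suffices h : wordEval q n ∘ₗ wordE (q : ℂ) (fun i => LinearMap.mulLeft ℂ (uK q n i))
      (fun i => LinearMap.mulLeft ℂ (uKi q n i)) (fun i => LinearMap.mulLeft ℂ (uE q n i)) i =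
      LinearMap.mulLeft ℂ (uE q n i) ∘ₗ wordEval q n from LinearMap.congr_fun h x
  refine words_hom_ext (fun v => ?_) fun l x hx => ?_
  · simp only [LinearMap.comp_apply, LinearMap.mulLeft_apply, wordE_single_nil,
      wordEval_single_nil]
  · have hl := LinearMap.congr_fun (sub_eq_iff_eq_add'.1
      (wordE_commutator_lower (q := (q : ℂ)) (κ := fun i => LinearMap.mulLeft ℂ (uK q n i))
        (κi := fun i => LinearMap.mulLeft ℂ (uKi q n i))
        (ε := fun i => LinearMap.mulLeft ℂ (uE q n i)) i l)) x
    have hc := sub_eq_iff_eq_add'.1 (uE_commutator_uF (q := q) hi hin l)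
    simp only [LinearMap.comp_apply, LinearMap.mulLeft_apply, Module.End.mul_apply,
      LinearMap.add_apply] at hx hl ⊢
    rw [hl, map_add, wordEval_lower, wordEval_lower, hx, ← mul_assoc, ← mul_assoc, hc, add_mul]
    congr 1
    split_ifs
    · simp only [wordBracket, LinearMap.smul_apply, LinearMap.sub_apply, Module.End.mul_apply,
        map_smul, map_sub, wordEval_wordK, wordEval_wordKi hq, smul_mul_assoc, sub_mul, mul_assoc]
    · simp

theorem serreSubmodule_le_ker_wordEval :
    serreSubmodule (q : ℂ) (Uq q n) ≤ LinearMap.ker (wordEval q n) := by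
  refine serreSubmodule_le ?_ fun j x hx => ?_
  · rintro S ⟨i, j, ⟨hij, rfl⟩ | ⟨hij, rfl⟩⟩ x
    · have := congrArg (· * wordEval q n x) (uF_commutator_uF (q := q) (m := n) hij)
      simpa [wordEval_lower, sub_mul, mul_assoc] using this
    · have := congrArg (· * wordEval q n x) (qSerre_uF (q := q) (m := n) hij)
      simpa [qSerre, pow_two, wordEval_lower, sub_mul, add_mul, mul_assoc] using this
  · rw [LinearMap.mem_ker] at hx ⊢
    rw [wordEval_lower, hx, mul_zero]

/-- `U_q(gl(n))` is a subquotient of a module over `U_q(gl(2n))`, on which the generators of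
`U_q(gl(2n))` with index different from `n` act by the generators of `U_q(gl(n))`. -/
theorem exists_induced_module (hq : (q : ℂ) ≠ 0) (m n : ℕ) :
    ∃ (T : Uq q m →ₐ[ℂ] Module.End ℂ (Words (Uq q n) ⧸ serreSubmodule (q : ℂ) (Uq q n)))
      (P : (Words (Uq q n) ⧸ serreSubmodule (q : ℂ) (Uq q n)) →ₗ[ℂ] Uq q n),
      Function.Surjective P ∧
      (∀ i, 1 ≤ i → i ≤ m → ∀ x, P (T (uK q m i) x) = uK q n i * P x ∧
        P (T (uKi q m i) x) = uKi q n i * P x) ∧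
      (∀ i, 1 ≤ i → i + 1 ≤ m → i ≠ n → ∀ x, P (T (uE q m i) x) = uE q n i * P x ∧
        P (T (uF q m i) x) = uF q n i * P x) := by
  have hB := borelRel_mulLeft q n
  have hcore := hB.glCore hq
  have hrel := GlCore.quotient (J := serreSubmodule (q : ℂ) (Uq q n)) (D := Set.Icc 1 m)
    { KK := fun i _ j _ => hcore.KK i trivial j trivial
      KKi := fun i _ => hcore.KKi i trivial
      KiK := fun i _ => hcore.KiK i trivial
      KE := fun i _ j _ _ => hcore.KE i trivial j trivial trivial
      KF := fun i _ j _ _ => hcore.KF i trivial j trivial trivial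
      EF := fun i _ _ j _ _ => hcore.EF i trivial trivial j trivial trivial }
    (fun i j hij => hB.wordE_commutator_wordE hq hij)
    (fun i j hij => hB.qSerre_wordE hq hij)
    (fun i j hij => serre_mem_serreSubmodule ⟨i, j, .inl ⟨hij, rfl⟩⟩)
    (fun i j hij => serre_mem_serreSubmodule ⟨i, j, .inr ⟨hij, rfl⟩⟩)
    (fun i x hx => diag_mem_serreSubmodule _ _ hx) (fun i x hx => diag_mem_serreSubmodule _ _ hx)
    (fun i x hx => hB.wordE_mem_serreSubmodule hq i hx)
    (fun i x hx => lower_mem_serreSubmodule i hx)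
  obtain ⟨T, hTK, hTE⟩ := hrel.exists_lift
  refine ⟨T, Submodule.liftQ _ (wordEval q n) serreSubmodule_le_ker_wordEval,
    fun u => ⟨Submodule.Quotient.mk (Finsupp.single [] u), wordEval_single_nil u⟩, ?_, ?_⟩
  · intro i hi hi' x
    obtain ⟨x, rfl⟩ := Submodule.Quotient.mk_surjective _ x
    rw [(hTK i hi hi').1, (hTK i hi hi').2]
    exact ⟨wordEval_wordK i x, wordEval_wordKi hq i x⟩
  · intro i hi hi' hin x
    obtain ⟨x, rfl⟩ := Submodule.Quotient.mk_surjective _ x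
    rw [(hTE i hi hi').1, (hTE i hi hi').2]
    exact ⟨wordEval_wordE hq hi hin x, wordEval_lower i x⟩

end QG

namespace QG

section Commute

variable {q : ℝ} {m i j : ℕ}

theorem commute_uK_uK : Commute (uK q m i) (uK q m j) := uK_mul_uK i j

theorem commute_uKi_uK : Commute (uKi q m i) (uK q m j) :=
  commute_of_inverse commute_uK_uK (uK_mul_uKi i) (uKi_mul_uK i)

theorem commute_uKi_uKi : Commute (uKi q m i) (uKi q m j) :=
  commute_of_inverse commute_uKi_uK.symm (uK_mul_uKi i) (uKi_mul_uK i)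

theorem commute_uK_uE (h : i ≠ j) (h' : i ≠ j + 1) : Commute (uK q m i) (uE q m j) := by
  simpa [kd, h, h', Commute, SemiconjBy] using uK_mul_uE (q := q) (m := m) i j

theorem commute_uK_uF (h : i ≠ j) (h' : i ≠ j + 1) : Commute (uK q m i) (uF q m j) := by
  simpa [kd, h, h', Commute, SemiconjBy] using uK_mul_uF (q := q) (m := m) i j

theorem commute_uKi_uE (h : i ≠ j) (h' : i ≠ j + 1) : Commute (uKi q m i) (uE q m j) :=
  commute_of_inverse (commute_uK_uE h h') (uK_mul_uKi i) (uKi_mul_uK i)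

theorem commute_uKi_uF (h : i ≠ j) (h' : i ≠ j + 1) : Commute (uKi q m i) (uF q m j) :=
  commute_of_inverse (commute_uK_uF h h') (uK_mul_uKi i) (uKi_mul_uK i)

theorem commute_uE_uF (hi : 1 ≤ i) (him : i ≠ m) (h : i ≠ j) :
    Commute (uE q m i) (uF q m j) := by
  simpa [h, sub_eq_zero, Commute, SemiconjBy] using uE_commutator_uF (q := q) hi him j

theorem commute_uE_uE (h : i + 2 ≤ j ∨ j + 2 ≤ i) : Commute (uE q m i) (uE q m j) :=
  sub_eq_zero.1 (uE_commutator_uE h)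

theorem commute_uF_uF (h : i + 2 ≤ j ∨ j + 2 ≤ i) : Commute (uF q m i) (uF q m j) :=
  sub_eq_zero.1 (uF_commutator_uF h)

end Commute

theorem neg_smul_sub {A : Type*} [Ring A] [Algebra ℂ A] (c : ℂ) (x y : A) :
    (-c) • (x - y) = c • (y - x) := by
  rw [neg_smul, ← smul_neg, neg_sub]

theorem glRel_restrict (q : ℝ) {n m : ℕ} (hnm : n ≤ m) :
    GlRel (q : ℂ) (Set.Icc 1 n) (uK q m) (uKi q m) (uE q m) (uF q m) where
  KK i _ j _ := uK_mul_uK i j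
  KKi i _ := uK_mul_uKi i
  KiK i _ := uKi_mul_uK i
  KE i _ j _ _ := uK_mul_uE i j
  KF i _ j _ _ := uK_mul_uF i j
  EF i hi hi' j _ _ := uE_commutator_uF hi.1 (by have := hi'.2; omega) j
  EE i _ _ j _ _ := uE_commutator_uE
  FF i _ _ j _ _ := uF_commutator_uF
  Eserre i _ _ j _ _ := qSerre_uE
  Fserre i _ _ j _ _ := qSerre_uF

/-- The diagram automorphism exchanging the two halves of `U_q(gl(2n))` gives a second family
satisfying the relations of `U_q(gl(n))`. -/
theorem glRel_reflect {q : ℝ} (n : ℕ) :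
    GlRel (q : ℂ) (Set.Icc 1 n) (fun i => uK q (2 * n) (2 * n + 1 - i))
      (fun i => uKi q (2 * n) (2 * n + 1 - i)) (fun i => uF q (2 * n) (2 * n - i))
      (fun i => uE q (2 * n) (2 * n - i)) where
  KK _ _ _ _ := uK_mul_uK _ _
  KKi _ _ := uK_mul_uKi _
  KiK _ _ := uKi_mul_uK _
  KE i hi j hj hj' := by
    simp only [Set.mem_Icc] at *
    rw [uK_mul_uF]
    congr 2
    unfold kd
    split_ifs <;> omega
  KF i hi j hj hj' := by
    simp only [Set.mem_Icc] at *
    rw [uK_mul_uE]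
    congr 2
    unfold kd
    split_ifs <;> omega
  EF i hi hi' j hj hj' := by
    simp only [Set.mem_Icc] at *
    have h := (glRel_restrict q (le_refl (2 * n))).FE (i := 2 * n - i) (j := 2 * n - j)
      ⟨by omega, by omega⟩ ⟨by omega, by omega⟩ ⟨by omega, by omega⟩ ⟨by omega, by omega⟩
    rw [h]
    by_cases hij : i = j
    · subst hij
      rw [if_pos rfl, if_pos rfl, neg_smul_sub,
        show 2 * n + 1 - (i + 1) = 2 * n - i by omega,
        show 2 * n - i + 1 = 2 * n + 1 - i by omega, commute_uKi_uK.eq,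
        (commute_uKi_uK (i := 2 * n + 1 - i)).eq]
    · rw [if_neg hij, if_neg (by omega)]
  EE i hi hi' j hj hj' hij := by
    simp only [Set.mem_Icc] at *
    exact uF_commutator_uF (by omega)
  FF i hi hi' j hj hj' hij := by
    simp only [Set.mem_Icc] at *
    exact uE_commutator_uE (by omega)
  Eserre i hi hi' j hj hj' hij := by
    simp only [Set.mem_Icc] at *
    exact qSerre_uF (by omega)
  Fserre i hi hi' j hj hj' hij := by
    simp only [Set.mem_Icc] at *
    exact qSerre_uE (by omega)

theorem commute_of_mem_glGens {q : ℝ} {n : ℕ} {x y : Uq q (2 * n)}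
    (hx : x ∈ glGens (Set.Icc 1 n) (uK q (2 * n)) (uKi q (2 * n)) (uE q (2 * n)) (uF q (2 * n)))
    (hy : y ∈ glGens (Set.Icc 1 n) (fun i => uK q (2 * n) (2 * n + 1 - i))
      (fun i => uKi q (2 * n) (2 * n + 1 - i)) (fun i => uF q (2 * n) (2 * n - i))
      (fun i => uE q (2 * n) (2 * n - i))) : Commute x y := by
  obtain ⟨i, hi, hx⟩ := hx
  obtain ⟨j, hj, hy⟩ := hy
  simp only [Set.mem_Icc] at *
  obtain rfl | rfl | ⟨hi', rfl | rfl⟩ := hx <;> obtain rfl | rfl | ⟨hj', rfl | rfl⟩ := hy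
  · exact commute_uK_uK
  · exact commute_uKi_uK.symm
  · exact commute_uK_uF (by omega) (by omega)
  · exact commute_uK_uE (by omega) (by omega)
  · exact commute_uKi_uK
  · exact commute_uKi_uKi
  · exact commute_uKi_uF (by omega) (by omega)
  · exact commute_uKi_uE (by omega) (by omega)
  · exact (commute_uK_uE (by omega) (by omega)).symm
  · exact (commute_uKi_uE (by omega) (by omega)).symm
  · exact commute_uE_uF (by omega) (by omega) (by omega)
  · exact commute_uE_uE (by omega)
  · exact (commute_uK_uF (by omega) (by omega)).symm
  · exact (commute_uKi_uF (by omega) (by omega)).symm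
  · exact commute_uF_uF (by omega)
  · exact (commute_uE_uF (by omega) (by omega) (by omega)).symm

theorem cancel_torus {A : Type*} [Ring A] {f e a ai b bi c : A} (ha : ai * a = 1) (hb : bi * b = 1)
    (hab : Commute bi a) (hce : Commute c e) :
    (f * ai * bi + c * e * bi) * (a * b) = f + e * (c * a) := by
  have h : bi * (a * b) = a := by rw [← mul_assoc, hab.eq, mul_assoc, hb, mul_one]
  rw [add_mul, mul_assoc _ bi, mul_assoc _ bi, h, mul_assoc f, ha, mul_one, hce.eq, mul_assoc]

variable {q : ℝ} {n j : ℕ}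

theorem Bb_mul_Cc (hj : 1 ≤ j) (hjn : j + 1 ≤ n) :
    Bb q n j * Cc q n (j + 1) = uF q (2 * n) j +
      uE q (2 * n) (2 * n - j) * (uKi q (2 * n) j * uK q (2 * n) (j + 1)) := by
  rw [Bb, Cc, show 2 * n + 1 - (j + 1) = 2 * n - j by omega]
  exact cancel_torus (uKi_mul_uK _) (uKi_mul_uK _) commute_uKi_uK
    (commute_uKi_uE (by omega) (by omega))

theorem Bb_reflect_mul_Cc (hj : 1 ≤ j) (hjn : j + 1 ≤ n) :
    Bb q n (2 * n - j) * Cc q n j = uE q (2 * n) j *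
      (uK q (2 * n) (2 * n + 1 - j) * uKi q (2 * n) (2 * n + 1 - (j + 1))) +
        uF q (2 * n) (2 * n - j) := by
  rw [Bb, Cc, show 2 * n - (2 * n - j) = j by omega, show 2 * n - j + 1 = 2 * n + 1 - j by omega,
    show 2 * n + 1 - (j + 1) = 2 * n - j by omega, uK_mul_uK, ← commute_uKi_uK.eq,
    add_comm (uE q (2 * n) j * _)]
  exact cancel_torus (uKi_mul_uK _) (uKi_mul_uK _) commute_uKi_uK
    (commute_uKi_uE (by omega) (by omega))

/-- The homomorphism `U_q(gl(n)) → U_q(gl(2n))` obtained from the coproduct. -/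
theorem exists_coproduct_hom (hq : (q : ℂ) ≠ 0) (n : ℕ) :
    ∃ ψ : Uq q n →ₐ[ℂ] Uq q (2 * n),
      (∀ i, 1 ≤ i → i ≤ n → ψ (uK q n i) = Cc q n i ∧ ψ (uKi q n i) = Ccinv q n i) ∧
      (∀ j, 1 ≤ j → j + 1 ≤ n →
        ψ (uF q n j) = Bb q n j * Cc q n (j + 1) ∧
        ψ (uE q n j) = Bb q n (2 * n - j) * Cc q n j) := by
  obtain ⟨ψ, hK, hE⟩ := ((glRel_restrict q (by omega : n ≤ 2 * n)).coproduct hq (glRel_reflect n)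
    fun _ hx _ hy => commute_of_mem_glGens hx hy).exists_lift
  refine ⟨ψ, hK, fun j hj hjn => ?_⟩
  rw [Bb_mul_Cc hj hjn, Bb_reflect_mul_Cc hj hjn]
  exact (hE j hj hjn).symm

theorem injective_of_coproduct (hq : (q : ℂ) ≠ 0) {ψ : Uq q n →ₐ[ℂ] Uq q (2 * n)}
    (hK : ∀ i, 1 ≤ i → i ≤ n → ψ (uK q n i) = Cc q n i ∧ ψ (uKi q n i) = Ccinv q n i)
    (hE : ∀ j, 1 ≤ j → j + 1 ≤ n → ψ (uF q n j) = Bb q n j * Cc q n (j + 1) ∧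
      ψ (uE q n j) = Bb q n (2 * n - j) * Cc q n j) : Function.Injective ψ := by
  obtain ⟨T, P, hP, hTK, hTE⟩ := exists_induced_module hq (2 * n) n
  have key : ∀ u x, P (T (ψ u) x) = u * P x := fun u => by
    induction u using Uq.induction with
    | hK i hi hin =>
      intro x
      rw [(hK i hi hin).1, Cc, map_mul, Module.End.mul_apply, (hTK i hi (by omega) _).1,
        (hTK (2 * n + 1 - i) (by omega) (by omega) _).1, uK_out (i := 2 * n + 1 - i) (by omega),
        one_mul]
    | hKi i hi hin =>
      intro x
      rw [(hK i hi hin).2, Ccinv, map_mul, Module.End.mul_apply, (hTK i hi (by omega) _).2,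
        (hTK (2 * n + 1 - i) (by omega) (by omega) _).2, uKi_out (i := 2 * n + 1 - i) (by omega),
        one_mul]
    | hE j hj hjn =>
      intro x
      rw [(hE j hj hjn).2, Bb_reflect_mul_Cc hj hjn, map_add, map_mul, map_mul,
        LinearMap.add_apply, map_add, Module.End.mul_apply, Module.End.mul_apply,
        (hTE j hj (by omega) (by omega) _).1, (hTK (2 * n + 1 - j) (by omega) (by omega) _).1,
        (hTK (2 * n + 1 - (j + 1)) (by omega) (by omega) _).2,
        (hTE (2 * n - j) (by omega) (by omega) (by omega) _).2,
        uK_out (i := 2 * n + 1 - j) (by omega), uKi_out (i := 2 * n + 1 - (j + 1)) (by omega),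
        uF_out (i := 2 * n - j) (by omega), one_mul, one_mul, zero_mul, add_zero]
    | hF j hj hjn =>
      intro x
      rw [(hE j hj hjn).1, Bb_mul_Cc hj hjn, map_add, map_mul, LinearMap.add_apply, map_add,
        Module.End.mul_apply, (hTE j hj (by omega) (by omega) _).2,
        (hTE (2 * n - j) (by omega) (by omega) (by omega) _).1,
        uE_out (i := 2 * n - j) (by omega), zero_mul, add_zero]
    | hc c => intro x; simp [Algebra.algebraMap_eq_smul_one]
    | hadd u v hu hv =>
      intro x
      rw [map_add, map_add, LinearMap.add_apply, map_add, hu, hv, add_mul]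
    | hmul u v hu hv =>
      intro x
      rw [map_mul, map_mul, Module.End.mul_apply, hu, hv, mul_assoc]
  obtain ⟨x, hx⟩ := hP 1
  refine fun u v huv => ?_
  rw [← mul_one u, ← mul_one v, ← hx, ← key, ← key, huv]

theorem range_of_coproduct {ψ : Uq q n →ₐ[ℂ] Uq q (2 * n)}
    (hK : ∀ i, 1 ≤ i → i ≤ n → ψ (uK q n i) = Cc q n i ∧ ψ (uKi q n i) = Ccinv q n i)
    (hE : ∀ j, 1 ≤ j → j + 1 ≤ n → ψ (uF q n j) = Bb q n j * Cc q n (j + 1) ∧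
      ψ (uE q n j) = Bb q n (2 * n - j) * Cc q n j) :
    ψ.range = Algebra.adjoin ℂ (ESet q n) := by
  have hC : ∀ i, 1 ≤ i → i ≤ n → Cc q n i ∈ Algebra.adjoin ℂ (ESet q n) :=
    fun i hi hin => Algebra.subset_adjoin (.inl ⟨i, hi, hin, .inl rfl⟩)
  have hB : ∀ j, 1 ≤ j → j + 1 ≤ 2 * n → j ≠ n → Bb q n j ∈ Algebra.adjoin ℂ (ESet q n) :=
    fun j hj hjn hne => Algebra.subset_adjoin (.inr ⟨j, hj, hjn, hne, rfl⟩)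
  have cancel : ∀ i, 1 ≤ i → i ≤ n → ∀ x, x * Cc q n i ∈ ψ.range → x ∈ ψ.range := by
    intro i hi hin x hx
    have h := mul_mem hx (ψ.mem_range_self (uKi q n i))
    rwa [mul_assoc, ← (hK i hi hin).1, ← map_mul, uK_mul_uKi, map_one, mul_one] at h
  refine le_antisymm ?_ (Algebra.adjoin_le ?_)
  · rintro _ ⟨u, rfl⟩
    change ψ u ∈ _
    induction u using Uq.induction with
    | hK i hi hin => exact (hK i hi hin).1 ▸ hC i hi hin
    | hKi i hi hin =>
      exact (hK i hi hin).2 ▸ Algebra.subset_adjoin (.inl ⟨i, hi, hin, .inr rfl⟩)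
    | hE j hj hjn =>
      exact (hE j hj hjn).2 ▸ mul_mem (hB _ (by omega) (by omega) (by omega)) (hC j hj (by omega))
    | hF j hj hjn =>
      exact (hE j hj hjn).1 ▸ mul_mem (hB j hj (by omega) (by omega)) (hC _ (by omega) hjn)
    | hc c => exact (ψ.commutes c).symm ▸ Subalgebra.algebraMap_mem _ c
    | hadd u v hu hv => exact (map_add ψ u v).symm ▸ add_mem hu hv
    | hmul u v hu hv => exact (map_mul ψ u v).symm ▸ mul_mem hu hv
  · rintro _ (⟨i, hi, hin, rfl | rfl⟩ | ⟨j, hj, hjn, hne, rfl⟩)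
    · exact ⟨_, (hK i hi hin).1⟩
    · exact ⟨_, (hK i hi hin).2⟩
    · rcases lt_or_gt_of_ne hne with h | h
      · exact cancel (j + 1) (by omega) h _ ⟨_, (hE j hj h).1⟩
      · have := (hE (2 * n - j) (by omega) (by omega)).2
        rw [show 2 * n - (2 * n - j) = j by omega] at this
        exact cancel (2 * n - j) (by omega) (by omega) _ ⟨_, this⟩

end QG

open QG in
/-- The assignment `K_i^{±1} ↦ C_i^{±1}` (`1 ≤ i ≤ n`), `y_j ↦ B_j C_{j+1}`,
`x_j ↦ B_{2n−j} C_j` (`1 ≤ j ≤ n−1`) extends to an algebra isomorphism from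
`U_q(gl(n))` onto the subalgebra `ℰ` of `U_q(gl(2n))` generated by the `C_i^{±1}`
(`1 ≤ i ≤ n`) and the `B_j` (`j ∈ {1,…,2n−1}`, `j ≠ n`). -/
theorem statement_8 (q : ℝ) (hq0 : 0 < q) (hq1 : q < 1) (n : ℕ) (hn : 1 ≤ n) :
    ∃ ψ : Uq q n →ₐ[ℂ] Uq q (2*n),
      (∀ i, 1 ≤ i → i ≤ n → ψ (uK q n i) = Cc q n i ∧ ψ (uKi q n i) = Ccinv q n i) ∧
      (∀ j, 1 ≤ j → j + 1 ≤ n →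
        ψ (uF q n j) = Bb q n j * Cc q n (j+1) ∧ ψ (uE q n j) = Bb q n (2*n-j) * Cc q n j) ∧
      Function.Injective ψ ∧
      ψ.range = Algebra.adjoin ℂ (ESet q n) := by
  have hq : (q : ℂ) ≠ 0 := Complex.ofReal_ne_zero.2 hq0.ne'
  obtain ⟨ψ, hK, hE⟩ := exists_coproduct_hom hq n
  exact ⟨ψ, hK, hE, injective_of_coproduct hq hK hE, range_of_coproduct hK hE⟩
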